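/- For all integers k ≥ 1, r ≥ 3, a ∈ {1,…,r−1}, b ∈ {1,…,r−2} with a ≢ b (mod 2), the following identity of formal power series in q holds: χ^{(r,(k+1)r−1)}_{a,(k+1)b}(q) = f_{a,b} · q^{−k((a−b)²−1)/4} Σ_{n ∈ (ℤ_{≥0})^k} Σ_{m ≡ Q_{a,b}} ( q^{nᵀB (n + ε_k)} / ((q)_{n_1} ⋯ (q)_{n_{k−1}} (q)_{2n_k+1}) ) · q^{(1/4) mᵀC m − (1/2) m_{r−a−1}} ∏_{j=1}^{r−3} [ (1/2)(I m + (2n_k+1) e_1 + e_{r−a−1} + e_{r−b−1})_j ; m_j ] (all exponents occurring are integers). -/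

import Mathlib

attribute [local instance] Classical.propDecidable

noncomputable section

variable {K : Type*} [Field K]

/-- `(q)_n` where `q = t^4` (the variable `t` stands for `q^{1/4}`). -/
def qp (t : K) (n : ℕ) : K :=
  ∏ k ∈ Finset.range n, (1 - t ^ (4 * (k + 1)))

/-- Gaussian polynomial `[N; m]` in the variable `q = t^4`. -/
def gauss (t : K) (N m : ℤ) : K :=
  if 0 ≤ m ∧ m ≤ N then qp t N.toNat / (qp t m.toNat * qp t (N - m).toNat) else 0

/-- Gaussian polynomial `[N2/2; m]` (zero if `N2` is odd). -/
def gaussHalf (t : K) (N2 m : ℤ) : K :=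
  if N2 % 2 = 0 then gauss t (N2 / 2) m else 0

/-- Incidence matrix of the Dynkin diagram `A_d` (indices `i : Fin d` stand for `i+1`). -/
def inc (d : ℕ) (i k : Fin d) : ℤ := if (i : ℕ) + 1 = (k : ℕ) ∨ (k : ℕ) + 1 = (i : ℕ) then 1 else 0

/-- Cartan matrix of `A_d`. -/
def cartan (d : ℕ) (i k : Fin d) : ℤ := (if i = k then 2 else 0) - inc d i k

/-- the `s`-th unit vector, with the convention `e_0 = e_{d+1} = 0`. -/
def uv (d : ℕ) (s : ℤ) (i : Fin d) : ℤ := if ((i : ℕ) : ℤ) + 1 = s then 1 else 0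

/-- `m_s`, with the conventions `m_0 = m_{d+1} = 0`. -/
def mAt (d : ℕ) (m : Fin d → ℕ) (s : ℤ) : ℤ := ∑ i, uv d s i * (m i : ℤ)

/-- `mᵀ C m` for the `A_d` Cartan matrix. -/
def quadC (d : ℕ) (m : Fin d → ℕ) : ℤ := ∑ i, ∑ k, (m i : ℤ) * cartan d i k * (m k : ℤ)

/-- the vector `Q_{a,b}`. -/
def Qab (r a b : ℕ) (i : Fin (r - 3)) : ℕ :=
  min (a - 1) (r - ((i : ℕ) + 1) - 2) + min (b - 1) (r - ((i : ℕ) + 1) - 2)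

/-- the parity restriction `m ≡ Q_{a,b} (mod 2)`. -/
def parity (r a b : ℕ) (m : Fin (r - 3) → ℕ) : Prop := ∀ i, m i % 2 = Qab r a b i % 2

/-- `(I m + L e_1 + e_{r-a-1} + e_{r-b-1})_i`. -/
def topE (r a b L : ℕ) (m : Fin (r - 3) → ℕ) (i : Fin (r - 3)) : ℤ :=
  (∑ k, inc (r - 3) i k * (m k : ℤ)) + (L : ℤ) * uv (r - 3) 1 i
    + uv (r - 3) ((r : ℤ) - a - 1) i + uv (r - 3) ((r : ℤ) - b - 1) i

/-- the summand `q^{(1/4) mᵀCm - (1/2) m_{r-a-1}} ∏_j [(1/2)(Im + Le_1 + e_{r-a-1} + e_{r-b-1})_j; m_j]`,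
in the variable `t = q^{1/4}`. -/
def fermTerm (r a b L : ℕ) (t : K) (m : Fin (r - 3) → ℕ) : K :=
  t ^ (quadC (r - 3) m - 2 * mAt (r - 3) m ((r : ℤ) - a - 1))
    * ∏ i, gaussHalf t (topE r a b L m i) (m i)

/-- the fermionic sum `Σ_{m ≡ Q_{a,b}} (⋯)`. -/
def fermSum (r a b L : ℕ) (t : K) : K :=
  ∑ᶠ m : Fin (r - 3) → ℕ, if parity r a b m then fermTerm r a b L t m else 0

/-- `(I m + c e_1 + e_{r-a-1} + e_{r-b-1})_i`. -/
def topC (r a b : ℕ) (c : ℤ) (m : Fin (r - 3) → ℕ) (i : Fin (r - 3)) : ℤ :=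
  (∑ k, inc (r - 3) i k * (m k : ℤ)) + c * uv (r - 3) 1 i
    + uv (r - 3) ((r : ℤ) - a - 1) i + uv (r - 3) ((r : ℤ) - b - 1) i

/-- `m_s` as a natural number (zero if `s` is out of range). -/
def mAtN (d : ℕ) (m : Fin d → ℕ) (s : ℕ) : ℕ :=
  ∑ i : Fin d, if (i : ℕ) + 1 = s then m i else 0

/-- the bilinear form `vᵀ B w` with `B_{j,ℓ} = min(j,ℓ)` (tadpole inverse Cartan matrix). -/
def tadB (k : ℕ) (v w : Fin k → ℤ) : ℤ :=
  ∑ i : Fin k, ∑ l : Fin k, v i * (min ((i : ℕ) + 1) ((l : ℕ) + 1) : ℤ) * w l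

/-- the variable `t = q^{1/4}` in the field of formal Laurent series `ℚ⸨X⸩`. -/
def tL : LaurentSeries ℚ := HahnSeries.single 1 1

/-- the Euler product `(q)_∞ = ∏_{k ≥ 1} (1 - q^k)` with `q = t^4`. -/
def eulerInf : LaurentSeries ℚ := ∏' k : ℕ, (1 - tL ^ (4 * (k + 1)))

/-- the normalized Virasoro character `χ^{(p,p')}_{R,S}(q)`, written in the variable
`t = q^{1/4}` (all exponents multiplied by `4`). -/
def virChar (p p' R S : ℕ) : LaurentSeries ℚ :=
  eulerInf⁻¹ * ∑' j : ℤ,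
    (tL ^ (4 * (j * ((p : ℤ) * p' * j + (p' : ℤ) * R - (p : ℤ) * S)))
      - tL ^ (4 * ((j * p + R) * (j * p' + S))))

/-- reciprocal of `(q)_n`, extended by zero to negative `n`. -/
def rq (t : K) (n : ℤ) : K := if 0 ≤ n then (qp t n.toNat)⁻¹ else 0

lemma qp_succ (t : K) (n : ℕ) : qp t (n + 1) = qp t n * (1 - t ^ (4 * (n + 1))) := by
  simp [qp, Finset.prod_range_succ]

lemma rq_nat (t : K) (n : ℕ) : rq t (n : ℤ) = (qp t n)⁻¹ := by simp [rq]

lemma rq_neg (t : K) {n : ℤ} (h : n < 0) : rq t n = 0 := by simp [rq, h]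

lemma rq_step {t : K} (hq : ∀ n, qp t n ≠ 0) (n : ℤ) :
    (1 - t ^ (4 * n)) * rq t n = rq t (n - 1) := by
  rcases lt_trichotomy n 0 with h | h | h
  · rw [rq_neg t h, rq_neg t (by omega), mul_zero]
  · subst h; rw [rq_neg t (by omega : (0:ℤ) - 1 < 0)]; simp
  · obtain ⟨k, rfl⟩ : ∃ k : ℕ, n = (k : ℤ) + 1 := ⟨(n - 1).toNat, by omega⟩
    have h1 := rq_nat t (k + 1)
    push_cast at h1
    rw [h1, add_sub_cancel_right, rq_nat, qp_succ]
    have h2 : t ^ (4 * ((k : ℤ) + 1)) = t ^ (4 * (k + 1)) := by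
      exact_mod_cast zpow_natCast t (4 * (k + 1))
    have h3 := hq (k + 1)
    rw [qp_succ] at h3
    have h4 := left_ne_zero_of_mul h3
    have h5 := right_ne_zero_of_mul h3
    rw [h2]
    field_simp

lemma gauss_nat (t : K) (N : ℕ) (m : ℤ) :
    gauss t N m = qp t N * (rq t m * rq t (N - m)) := by
  unfold gauss rq
  by_cases h1 : 0 ≤ m
  · by_cases h2 : m ≤ N
    · rw [if_pos ⟨h1, h2⟩, if_pos h1, if_pos (by omega)]
      simp only [Int.toNat_natCast]
      rw [div_eq_mul_inv, mul_inv]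
    · rw [if_neg (by tauto), if_neg (by omega : ¬ 0 ≤ (N:ℤ) - m)]; simp
  · rw [if_neg (by tauto), if_neg h1]; simp

lemma gauss_neg (t : K) {N : ℤ} (m : ℤ) (h : N < 0) : gauss t N m = 0 := by
  unfold gauss; rw [if_neg (by omega)]

lemma gauss_pascal {t : K} (ht : t ≠ 0) (hq : ∀ n, qp t n ≠ 0) (N m : ℤ) (hN : N ≠ 0) :
    gauss t N m = gauss t (N - 1) m + t ^ (4 * (N - m)) * gauss t (N - 1) (m - 1) := by
  rcases lt_or_gt_of_ne hN with h | h
  · rw [gauss_neg t _ h, gauss_neg t _ (by omega), gauss_neg t _ (by omega)]; simp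
  · obtain ⟨k, rfl⟩ : ∃ k : ℕ, N = (k : ℤ) + 1 := ⟨(N - 1).toNat, by omega⟩
    have h1 := gauss_nat t (k + 1) m
    push_cast at h1
    rw [h1, add_sub_cancel_right, gauss_nat, gauss_nat, qp_succ]
    have e1 := rq_step hq m
    have e2 := rq_step hq ((k : ℤ) + 1 - m)
    rw [← e1, show (k : ℤ) - m = (k : ℤ) + 1 - m - 1 by ring, ← e2,
      show (k : ℤ) - (m - 1) = (k : ℤ) + 1 - m by ring]
    have h2 : t ^ (4 * (k + 1)) = t ^ (4 * ((k : ℤ) + 1 - m)) * t ^ (4 * m) := by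
      rw [← zpow_add₀ ht, ← zpow_natCast]; congr 1; push_cast; ring
    rw [h2]; ring

lemma gaussHalf_pascal {t : K} (ht : t ≠ 0) (hq : ∀ n, qp t n ≠ 0) (N m : ℤ) (hN : 1 ≤ N) :
    gaussHalf t N m = gaussHalf t (N - 2) m
      + t ^ (2 * N - 4 * m) * gaussHalf t (N - 2) (m - 1) := by
  unfold gaussHalf
  by_cases h : N % 2 = 0
  · rw [if_pos h, if_pos (by omega), if_pos (by omega), gauss_pascal ht hq _ _ (by omega),
      show (N - 2) / 2 = N / 2 - 1 by omega, show 4 * (N / 2 - m) = 2 * N - 4 * m by omega]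
  · rw [if_neg h, if_neg (by omega), if_neg (by omega)]; simp

/-- summand of the generalized fermionic sum. -/
def fT (d : ℕ) (s : ℤ) (t : K) (P U : ℤ → ℤ) (m : Fin d → ℕ) : K :=
  if (∀ i : Fin d, ((m i : ℤ) - P ((i : ℕ) + 1)) % 2 = 0) then
    t ^ (quadC d m - 2 * mAt d m s)
      * ∏ i : Fin d, gaussHalf t ((∑ k, inc d i k * (m k : ℤ)) + U ((i : ℕ) + 1)) (m i)
  else 0

/-- generalized fermionic sum. -/
def FS (d : ℕ) (s : ℤ) (t : K) (P U : ℤ → ℤ) : K := ∑ᶠ m, fT d s t P U m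

lemma FS_congr (d : ℕ) (s : ℤ) (t : K) {P P' U U' : ℤ → ℤ}
    (hP : ∀ i : ℤ, 1 ≤ i → i ≤ d → (P i - P' i) % 2 = 0)
    (hU : ∀ i : ℤ, 1 ≤ i → i ≤ d → U i = U' i) : FS d s t P U = FS d s t P' U' := by
  unfold FS
  congr 1
  funext m
  unfold fT
  have h1 : (∀ i : Fin d, ((m i : ℤ) - P ((i : ℕ) + 1)) % 2 = 0) ↔
      (∀ i : Fin d, ((m i : ℤ) - P' ((i : ℕ) + 1)) % 2 = 0) := by
    refine forall_congr' fun i => ?_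
    have := hP ((i : ℕ) + 1) (by omega) (by have := i.2; omega)
    omega
  have h2 : ∀ i : Fin d, U ((i : ℕ) + 1) = U' ((i : ℕ) + 1) := fun i =>
    hU _ (by omega) (by have := i.2; omega)
  simp only [h1, h2]

lemma inc_symm (d : ℕ) (i k : Fin d) : inc d i k = inc d k i := by
  unfold inc; congr 1; rw [eq_iff_iff]; tauto

lemma inc_self (d : ℕ) (i : Fin d) : inc d i i = 0 := by
  unfold inc; simp

lemma gaussHalf_ne {t : K} {N m : ℤ} (h : gaussHalf t N m ≠ 0) :
    N % 2 = 0 ∧ 2 * m ≤ N := by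
  unfold gaussHalf gauss at h
  by_cases h1 : N % 2 = 0
  · rw [if_pos h1] at h
    by_cases h2 : 0 ≤ m ∧ m ≤ N / 2
    · exact ⟨h1, by omega⟩
    · rw [if_neg h2] at h; exact absurd rfl h
  · rw [if_neg h1] at h; exact absurd rfl h

lemma fT_ne {d : ℕ} {s : ℤ} {t : K} {P U : ℤ → ℤ} {m : Fin d → ℕ} (h : fT d s t P U m ≠ 0) :
    (∀ i : Fin d, ((m i : ℤ) - P ((i : ℕ) + 1)) % 2 = 0) ∧
    (∀ i : Fin d, ((∑ k, inc d i k * (m k : ℤ)) + U ((i : ℕ) + 1)) % 2 = 0 ∧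
      2 * (m i : ℤ) ≤ (∑ k, inc d i k * (m k : ℤ)) + U ((i : ℕ) + 1)) := by
  unfold fT at h
  by_cases h1 : ∀ i : Fin d, ((m i : ℤ) - P ((i : ℕ) + 1)) % 2 = 0
  · rw [if_pos h1] at h
    refine ⟨h1, fun i => gaussHalf_ne (t := t) ?_⟩
    exact Finset.prod_ne_zero_iff.mp (right_ne_zero_of_mul h) i (Finset.mem_univ i)
  · rw [if_neg h1] at h; exact absurd rfl h

/-- `Σ_k inc i k x_k = x_{i-1} + x_{i+1}` for an extended function. -/
lemma inc_sum (d : ℕ) (i : Fin d) (x : ℤ → ℤ) (h0 : x 0 = 0) (hd : x (d + 1) = 0) :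
    ∑ k : Fin d, inc d i k * x ((k : ℕ) + 1) = x (i : ℕ) + x ((i : ℕ) + 2) := by
  have h : ∀ k : Fin d, inc d i k * x ((k : ℕ) + 1) =
      (if (k : ℕ) + 1 = (i : ℕ) then x (i : ℕ) else 0)
        + (if (i : ℕ) + 1 = (k : ℕ) then x ((i : ℕ) + 2) else 0) := by
    intro k
    unfold inc
    by_cases h1 : (k : ℕ) + 1 = (i : ℕ)
    · rw [if_pos (Or.inr h1), if_pos h1, if_neg (by omega), ← h1]; push_cast; ring
    · by_cases h2 : (i : ℕ) + 1 = (k : ℕ)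
      · rw [if_pos (Or.inl h2), if_neg h1, if_pos h2, ← h2]; push_cast; ring_nf
      · rw [if_neg (by tauto), if_neg h1, if_neg h2]; ring
  rw [Finset.sum_congr rfl fun k _ => h k, Finset.sum_add_distrib]
  congr 1
  · rcases Nat.eq_zero_or_pos (i : ℕ) with h0' | h0'
    · rw [Finset.sum_eq_zero, h0']
      · simp [h0]
      · intro k _; rw [if_neg (by omega)]
    · rw [Finset.sum_eq_single (⟨(i : ℕ) - 1, by omega⟩ : Fin d)]
      · rw [if_pos (by simp; omega)]
      · intro k _ hk; rw [if_neg]; intro h; apply hk; ext; simp; omega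
      · simp
  · by_cases h1 : (i : ℕ) + 1 < d
    · rw [Finset.sum_eq_single (⟨(i : ℕ) + 1, h1⟩ : Fin d)]
      · simp
      · intro k _ hk; rw [if_neg]; intro h; apply hk; ext; simp; omega
      · simp
    · rw [Finset.sum_eq_zero]
      · rw [show ((i : ℕ) : ℤ) + 2 = d + 1 by omega, hd]
      · intro k _; rw [if_neg (by omega)]

lemma fT_support (d : ℕ) (s : ℤ) (t : K) (P U : ℤ → ℤ) :
    (Function.support (fT d s t P U)).Finite := by
  let h : ℤ → ℤ := fun x => x * (d + 1 - x)
  let B : ℤ := ∑ i : Fin d, h ((i : ℕ) + 1) * |U ((i : ℕ) + 1)|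
  refine Set.Finite.subset (Set.Finite.pi' (fun _ : Fin d => Set.finite_Iic B.toNat)) ?_
  intro m hm
  have h2 := (fT_ne (Function.mem_support.mp hm)).2
  have hh : ∀ i : Fin d, 0 ≤ h ((i : ℕ) + 1) := fun i => by
    have := i.2
    exact mul_nonneg (by omega) (by omega)
  have h3 : ∑ i : Fin d, h ((i : ℕ) + 1) * (2 * (m i : ℤ)) ≤
      ∑ i : Fin d, h ((i : ℕ) + 1) * ((∑ k, inc d i k * (m k : ℤ)) + |U ((i : ℕ) + 1)|) := by
    refine Finset.sum_le_sum fun i _ => mul_le_mul_of_nonneg_left ?_ (hh i)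
    have := (h2 i).2
    have := le_abs_self (U ((i : ℕ) + 1))
    linarith
  have h4 : ∑ i : Fin d, h ((i : ℕ) + 1) * (∑ k, inc d i k * (m k : ℤ)) =
      ∑ k : Fin d, (m k : ℤ) * (h (k : ℕ) + h ((k : ℕ) + 2)) := by
    simp only [Finset.mul_sum]
    rw [Finset.sum_comm]
    refine Finset.sum_congr rfl fun k _ => ?_
    rw [← inc_sum d k h (by simp [h]) (by simp [h]), Finset.mul_sum]
    refine Finset.sum_congr rfl fun i _ => ?_
    rw [inc_symm d i k]; ring
  simp only [mul_add (h _), Finset.sum_add_distrib] at h3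
  rw [h4] at h3
  have h5 : ∑ i : Fin d, h ((i : ℕ) + 1) * (2 * (m i : ℤ)) =
      ∑ k : Fin d, (m k : ℤ) * (h (k : ℕ) + h ((k : ℕ) + 2)) + 2 * ∑ k : Fin d, (m k : ℤ) := by
    rw [Finset.mul_sum, ← Finset.sum_add_distrib]
    refine Finset.sum_congr rfl fun i _ => ?_
    simp only [h]; ring
  have h6 : ∑ k : Fin d, (m k : ℤ) ≤ B := by
    have : 0 ≤ ∑ k : Fin d, (m k : ℤ) := Finset.sum_nonneg fun i _ => by positivity
    rw [h5] at h3
    simp only [B]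
    linarith
  intro i
  have h7 : (m i : ℤ) ≤ ∑ k : Fin d, (m k : ℤ) :=
    Finset.single_le_sum (f := fun k => (m k : ℤ)) (fun i _ => by positivity) (Finset.mem_univ i)
  simp only [Set.mem_Iic]
  omega

/-- add one to the `j`-th entry. -/
def shiftM {d : ℕ} (m : Fin d → ℕ) (j : Fin d) : Fin d → ℕ := fun i => m i + if i = j then 1 else 0

lemma shiftM_cast {d : ℕ} (m : Fin d → ℕ) (j : Fin d) (i : Fin d) :
    (shiftM m j i : ℤ) = (m i : ℤ) + if i = j then 1 else 0 := by
  unfold shiftM; push_cast; rfl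

lemma quadC_shift (d : ℕ) (m : Fin d → ℕ) (j : Fin d) :
    quadC d (shiftM m j) = quadC d m
      + 2 * (2 * (m j : ℤ) - ∑ k, inc d j k * (m k : ℤ)) + 2 := by
  have hc := shiftM_cast m j
  have hrow : ∑ k, cartan d j k * (m k : ℤ) = 2 * (m j : ℤ) - ∑ k, inc d j k * (m k : ℤ) := by
    simp [cartan, sub_mul, Finset.sum_sub_distrib]
  have hsym : ∀ i k, cartan d i k = cartan d k i := by
    intro i k; unfold cartan; rw [inc_symm]; simp [eq_comm]
  unfold quadC
  simp only [hc]
  have : ∀ i k : Fin d, ((m i : ℤ) + if i = j then 1 else 0) * cartan d i k *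
      ((m k : ℤ) + if k = j then 1 else 0) = (m i : ℤ) * cartan d i k * (m k : ℤ)
      + (if k = j then (m i : ℤ) * cartan d i k else 0)
      + (if i = j then cartan d i k * (m k : ℤ) else 0)
      + (if i = j then (if k = j then cartan d i k else 0) else 0) := by
    intro i k; split_ifs <;> ring
  simp only [this, Finset.sum_add_distrib]
  have e1 : ∑ i : Fin d, ∑ k : Fin d, (if k = j then (m i : ℤ) * cartan d i k else 0)
      = ∑ k, cartan d j k * (m k : ℤ) := by
    simp only [Finset.sum_ite_eq', Finset.mem_univ, if_true]
    exact Finset.sum_congr rfl fun i _ => by rw [hsym i j]; ring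
  have e2 : ∑ i : Fin d, ∑ k : Fin d, (if i = j then cartan d i k * (m k : ℤ) else 0)
      = ∑ k, cartan d j k * (m k : ℤ) := by
    rw [Finset.sum_comm]
    simp
  have e3 : ∑ i : Fin d, ∑ k : Fin d,
      (if i = j then (if k = j then cartan d i k else 0) else 0) = 2 := by
    simp [cartan, inc_self]
  rw [e1, e2, e3, hrow]; ring

lemma mAt_shift (d : ℕ) (m : Fin d → ℕ) (j : Fin d) (s : ℤ) :
    mAt d (shiftM m j) s = mAt d m s + if ((j : ℕ) : ℤ) + 1 = s then 1 else 0 := by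
  unfold mAt
  have hc := shiftM_cast m j
  simp only [hc, mul_add, Finset.sum_add_distrib]
  simp [uv]

lemma inc_shift (d : ℕ) (m : Fin d → ℕ) (i j : Fin d) :
    ∑ k, inc d i k * (shiftM m j k : ℤ) = ∑ k, inc d i k * (m k : ℤ) + inc d i j := by
  have hc := shiftM_cast m j
  simp only [hc, mul_add, Finset.sum_add_distrib]
  simp

/-- unit vectors on `ℤ`. -/
def eZ (s x : ℤ) : ℤ := if x = s then 1 else 0

lemma inc_eZ (d : ℕ) (i j : Fin d) :
    inc d i j = eZ (j : ℕ) ((i : ℕ) + 1) + eZ ((j : ℕ) + 2) ((i : ℕ) + 1) := by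
  unfold inc eZ
  split_ifs <;> omega


lemma inc_sum_nonneg (d : ℕ) (i : Fin d) (m : Fin d → ℕ) : 0 ≤ ∑ k, inc d i k * (m k : ℤ) := by
  refine Finset.sum_nonneg fun k _ => mul_nonneg ?_ (by positivity)
  unfold inc; split_ifs <;> simp

/-- the shifted vector in the `q`-Pascal recursion. -/
def Ush (j : ℤ) (U : ℤ → ℤ) (x : ℤ) : ℤ := U x - 2 * eZ j x + eZ (j - 1) x + eZ (j + 1) x

lemma fT_pascal_zero {d : ℕ} (s : ℤ) {t : K} (ht : t ≠ 0) (hq : ∀ n, qp t n ≠ 0)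
    (P U : ℤ → ℤ) (j : Fin d) (hU : 1 ≤ U ((j : ℕ) + 1)) (m : Fin d → ℕ) (hm : m j = 0) :
    fT d s t P U m = fT d s t P (fun x => U x - 2 * eZ ((j : ℕ) + 1) x) m := by
  unfold fT
  congr 2
  refine Finset.prod_congr rfl fun i _ => ?_
  by_cases h : i = j
  · subst h
    have h0 := inc_sum_nonneg d i m
    rw [hm, gaussHalf_pascal ht hq _ _ (by omega)]
    have : gaussHalf t ((∑ k, inc d i k * (m k : ℤ)) + U ((i : ℕ) + 1) - 2) (((0 : ℕ) : ℤ) - 1) = 0 := by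
      unfold gaussHalf gauss; simp
    rw [this, mul_zero, add_zero]
    congr 1
    simp [eZ]; ring
  · have : ¬ (((i : ℕ) : ℤ) + 1 = (j : ℕ) + 1) := by
      intro h'; apply h; ext; omega
    simp [eZ, this]

lemma fT_pascal_succ {d : ℕ} (s : ℤ) {t : K} (ht : t ≠ 0) (hq : ∀ n, qp t n ≠ 0)
    (P U : ℤ → ℤ) (j : Fin d) (hU : 1 ≤ U ((j : ℕ) + 1)) (m : Fin d → ℕ) :
    fT d s t P U (shiftM m j) =
      fT d s t P (fun x => U x - 2 * eZ ((j : ℕ) + 1) x) (shiftM m j)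
      + t ^ (2 * (U ((j : ℕ) + 1) - 1 - eZ s ((j : ℕ) + 1)))
        * fT d s t (fun x => P x + eZ ((j : ℕ) + 1) x) (Ush ((j : ℕ) + 1) U) m := by
  have hpar : (∀ i : Fin d, ((m i : ℤ) - (P ((i : ℕ) + 1) + eZ ((j : ℕ) + 1) ((i : ℕ) + 1))) % 2 = 0)
      ↔ (∀ i : Fin d, ((shiftM m j i : ℤ) - P ((i : ℕ) + 1)) % 2 = 0) := by
    refine forall_congr' fun i => ?_
    rw [shiftM_cast]
    by_cases h : i = j
    · subst h; simp only [eZ, if_true]; omega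
    · have : ¬ (((i : ℕ) : ℤ) + 1 = (j : ℕ) + 1) := by
        intro h'; apply h; ext; omega
      simp [eZ, this, h]
  unfold fT
  simp only [hpar]
  by_cases hp : ∀ i : Fin d, ((shiftM m j i : ℤ) - P ((i : ℕ) + 1)) % 2 = 0
  swap
  · simp only [if_neg hp]; simp
  simp only [if_pos hp]
  rw [← Finset.mul_prod_erase Finset.univ _ (Finset.mem_univ j),
    ← Finset.mul_prod_erase Finset.univ
      (fun i : Fin d => gaussHalf t ((∑ k, inc d i k * (shiftM m j k : ℤ)) +
        (U ((i : ℕ) + 1) - 2 * eZ ((j : ℕ) + 1) ((i : ℕ) + 1))) (shiftM m j i)) (Finset.mem_univ j),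
    ← Finset.mul_prod_erase Finset.univ
      (fun i : Fin d => gaussHalf t ((∑ k, inc d i k * (m k : ℤ)) +
        Ush ((j : ℕ) + 1) U ((i : ℕ) + 1)) (m i)) (Finset.mem_univ j)]
  have e1 : ∏ i ∈ Finset.univ.erase j, gaussHalf t ((∑ k, inc d i k * (shiftM m j k : ℤ)) +
        (U ((i : ℕ) + 1) - 2 * eZ ((j : ℕ) + 1) ((i : ℕ) + 1))) (shiftM m j i)
      = ∏ i ∈ Finset.univ.erase j, gaussHalf t ((∑ k, inc d i k * (shiftM m j k : ℤ)) +
        U ((i : ℕ) + 1)) (shiftM m j i) := by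
    refine Finset.prod_congr rfl fun i hi => ?_
    have h := Finset.ne_of_mem_erase hi
    have : ¬ (((i : ℕ) : ℤ) + 1 = (j : ℕ) + 1) := by
      intro h'; apply h; ext; omega
    simp [eZ, this]
  have e2 : ∏ i ∈ Finset.univ.erase j, gaussHalf t ((∑ k, inc d i k * (m k : ℤ)) +
        Ush ((j : ℕ) + 1) U ((i : ℕ) + 1)) (m i)
      = ∏ i ∈ Finset.univ.erase j, gaussHalf t ((∑ k, inc d i k * (shiftM m j k : ℤ)) +
        U ((i : ℕ) + 1)) (shiftM m j i) := by
    refine Finset.prod_congr rfl fun i hi => ?_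
    have h := Finset.ne_of_mem_erase hi
    have h2 : ¬ (((i : ℕ) : ℤ) + 1 = (j : ℕ) + 1) := by
      intro h'; apply h; ext; omega
    rw [inc_shift, shiftM_cast, if_neg h, add_zero, inc_eZ]
    congr 1
    unfold Ush
    rw [show eZ ((j : ℕ) + 1) ((i : ℕ) + 1) = 0 by simp [eZ]; omega]
    rw [show (((j : ℕ) : ℤ) + 1 - 1) = (j : ℕ) by ring,
      show (((j : ℕ) : ℤ) + 1 + 1) = (j : ℕ) + 2 by ring]
    ring
  rw [e1, e2, inc_shift, inc_self, add_zero, shiftM_cast, if_pos rfl, quadC_shift, mAt_shift]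
  have h0 := inc_sum_nonneg d j m
  rw [gaussHalf_pascal ht hq _ _ (by omega)]
  have u1 : Ush ((j : ℕ) + 1) U ((j : ℕ) + 1) = U ((j : ℕ) + 1) - 2 := by
    unfold Ush eZ; simp
  have u2 : eZ ((j : ℕ) + 1) ((j : ℕ) + 1) = 1 := by simp [eZ]
  have u3 : eZ s ((j : ℕ) + 1) = if ((j : ℕ) : ℤ) + 1 = s then 1 else 0 := rfl
  rw [u1, u2, ← u3]
  set S := ∑ k, inc d j k * (m k : ℤ)
  set V := U ((j : ℕ) + 1)
  rw [show S + V - 2 = S + (V - 2) by ring, show (m j : ℤ) + 1 - 1 = m j by ring, mul_one]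
  rw [show quadC d m + 2 * (2 * (m j : ℤ) - S) + 2 - 2 * (mAt d m s + eZ s ((j : ℕ) + 1))
    = (2 * (V - 1 - eZ s ((j : ℕ) + 1))) + (quadC d m - 2 * mAt d m s)
      - (2 * (S + V) - 4 * ((m j : ℤ) + 1)) by ring]
  rw [zpow_sub₀ ht, zpow_add₀ ht]
  have hz : t ^ (2 * (S + V) - 4 * ((m j : ℤ) + 1)) ≠ 0 := zpow_ne_zero _ ht
  field_simp

lemma shiftM_inj {d : ℕ} (j : Fin d) : Function.Injective (fun m : Fin d → ℕ => shiftM m j) := by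
  intro m m' h
  funext i
  have := congrFun h i
  simp only [shiftM] at this
  omega

lemma FS_pascal_fin {d : ℕ} (s : ℤ) {t : K} (ht : t ≠ 0) (hq : ∀ n, qp t n ≠ 0)
    (P U : ℤ → ℤ) (j : Fin d) (hU : 1 ≤ U ((j : ℕ) + 1)) :
    FS d s t P U = FS d s t P (fun x => U x - 2 * eZ ((j : ℕ) + 1) x)
      + t ^ (2 * (U ((j : ℕ) + 1) - 1 - eZ s ((j : ℕ) + 1)))
        * FS d s t (fun x => P x + eZ ((j : ℕ) + 1) x) (Ush ((j : ℕ) + 1) U) := by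
  set D : (Fin d → ℕ) → K := fun m => fT d s t P U m
    - fT d s t P (fun x => U x - 2 * eZ ((j : ℕ) + 1) x) m with hD
  have h1 : FS d s t P U - FS d s t P (fun x => U x - 2 * eZ ((j : ℕ) + 1) x) = ∑ᶠ m, D m := by
    unfold FS
    have hf : ∀ P U, Function.HasFiniteSupport (fT d s t P U) := fun P U => fT_support d s t P U
    rw [← finsum_sub_distrib (hf _ _) (hf _ _)]
  have hr : Function.support D ⊆ Set.range (fun m : Fin d → ℕ => shiftM m j) := by
    intro m hm
    by_cases h : m j = 0
    · exact absurd (sub_eq_zero.mpr (fT_pascal_zero s ht hq P U j hU m h)) hm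
    · refine ⟨fun i => m i - if i = j then 1 else 0, ?_⟩
      funext i
      simp only [shiftM]
      by_cases h' : i = j
      · subst h'; simp; omega
      · simp [h']
  have h2 : ∑ᶠ m, D m = ∑ᶠ m, D (shiftM m j) := by
    rw [← finsum_mem_range (shiftM_inj j)]
    rw [← finsum_mem_univ]
    exact finsum_mem_inter_support_eq' _ _ _ (fun x hx => ⟨fun _ => hr hx, fun _ => Set.mem_univ x⟩)
  have h3 : ∀ m, D (shiftM m j) = t ^ (2 * (U ((j : ℕ) + 1) - 1 - eZ s ((j : ℕ) + 1)))
        * fT d s t (fun x => P x + eZ ((j : ℕ) + 1) x) (Ush ((j : ℕ) + 1) U) m := by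
    intro m
    simp only [hD]
    rw [fT_pascal_succ s ht hq P U j hU m]; ring
  rw [← sub_eq_iff_eq_add', h1, h2]
  simp only [h3]
  unfold FS
  rw [mul_finsum]

/-- `q`-Pascal recursion, flexible form. -/
lemma FS_pascal {d : ℕ} {s : ℤ} {t : K} (ht : t ≠ 0) (hq : ∀ n, qp t n ≠ 0)
    {P U : ℤ → ℤ} (j : ℤ) (hj : 1 ≤ j) (hjd : j ≤ d) (hU : 1 ≤ U j)
    (e : ℤ) (U1 P2 U2 : ℤ → ℤ) (he : e = 2 * (U j - 1 - eZ s j))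
    (h1 : ∀ x : ℤ, 1 ≤ x → x ≤ d → U1 x = U x - 2 * eZ j x)
    (h2 : ∀ x : ℤ, 1 ≤ x → x ≤ d → (P2 x - P x - eZ j x) % 2 = 0)
    (h3 : ∀ x : ℤ, 1 ≤ x → x ≤ d → U2 x = U x - 2 * eZ j x + eZ (j - 1) x + eZ (j + 1) x) :
    FS d s t P U = FS d s t P U1 + t ^ e * FS d s t P2 U2 := by
  obtain ⟨i, rfl⟩ : ∃ i : Fin d, j = ((i : ℕ) : ℤ) + 1 := ⟨⟨(j - 1).toNat, by omega⟩, by simp; omega⟩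
  rw [FS_pascal_fin s ht hq P U i hU, he]
  congr 1
  · exact FS_congr _ _ _ (fun _ _ _ => by simp) fun x hx hx' => (h1 x hx hx').symm
  · congr 1
    exact FS_congr _ _ _ (fun x hx hx' => by have := h2 x hx hx'; omega)
      fun x hx hx' => (h3 x hx hx').symm


/-- indicator of `x ≤ c`. -/
def sZ (c x : ℤ) : ℤ := if x ≤ c then 1 else 0

lemma FS_T {d : ℕ} {s : ℤ} {t : K} (ht : t ≠ 0) (hq : ∀ n, qp t n ≠ 0)
    (P X : ℤ → ℤ) (y : ℤ) (hy : y = X 1 - eZ s 1) (h1 : 0 ≤ X 1) (c : ℤ) (hc : 2 ≤ c) :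
    c ≤ d → (∀ i : ℤ, 2 ≤ i → i ≤ c → 0 ≤ X i) → (∀ i : ℤ, 2 ≤ i → i < c → X i = eZ s i) →
    FS d s t P (fun x => X x + eZ 1 x) =
      (1 - t ^ (4 * y)) * FS d s t P (fun x => X x - eZ 1 x)
      + t ^ (2 * y) * FS d s t (fun x => P x + sZ (c - 1) x) (fun x => X x + eZ (c - 1) x - eZ c x)
      + t ^ (2 * y + 2 * (X c - eZ s c)) *
        FS d s t (fun x => P x + sZ c x) (fun x => X x + eZ (c + 1) x - eZ c x) := by
  induction c, hc using Int.leInduction with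
  | base =>
    intro hd hX _
    have hX2 := hX 2 le_rfl le_rfl
    have a1 := FS_pascal (d := d) (s := s) ht hq (P := P) (U := fun x => X x + eZ 1 x) 1 le_rfl
      (by omega) (by simp [eZ]; omega) (2 * y) (fun x => X x - eZ 1 x)
      (fun x => P x + eZ 1 x) (fun x => X x - eZ 1 x + eZ 2 x)
      (by simp [eZ] at *; omega) (by intro x _ _; simp only [eZ]; split_ifs <;> omega)
      (by intro x _ _; simp only [eZ]; split_ifs <;> omega)
      (by intro x _ _; simp only [eZ]; split_ifs <;> omega)
    have a2 := FS_pascal (d := d) (s := s) ht hq (P := fun x => P x + eZ 1 x)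
      (U := fun x => X x - eZ 1 x + eZ 2 x) 2 (by norm_num)
      (by omega) (by simp [eZ]; omega) (2 * (X 2 - eZ s 2)) (fun x => X x - eZ 1 x - eZ 2 x)
      (fun x => P x + sZ 2 x) (fun x => X x + eZ (2 + 1) x - eZ 2 x)
      (by simp [eZ] at *) (by intro x _ _; simp only [eZ]; split_ifs <;> omega)
      (by intro x _ _; simp only [eZ, sZ]; split_ifs <;> omega)
      (by intro x _ _; simp only [eZ]; split_ifs <;> omega)
    have a3 := FS_pascal (d := d) (s := s) ht hq (P := fun x => P x + sZ (2 - 1) x)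
      (U := fun x => X x + eZ (2 - 1) x - eZ 2 x) 1 (by norm_num)
      (by omega) (by simp [eZ]; omega) (2 * y) (fun x => X x - eZ 1 x - eZ 2 x)
      P (fun x => X x - eZ 1 x)
      (by simp [eZ] at *; omega) (by intro x _ _; simp only [eZ]; split_ifs <;> omega)
      (by intro x _ _; simp only [eZ, sZ]; split_ifs <;> omega)
      (by intro x _ _; simp only [eZ]; split_ifs <;> omega)
    have a4 : FS d s t (fun x => P x + sZ (2 - 1) x) (fun x => X x - eZ 1 x - eZ 2 x)
        = FS d s t (fun x => P x + eZ 1 x) (fun x => X x - eZ 1 x - eZ 2 x) :=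
      FS_congr _ _ _ (by intro x _ _; simp only [eZ, sZ]; split_ifs <;> omega) (fun _ _ _ => rfl)
    rw [a1, a3, a4, a2, zpow_add₀ ht, show 4 * y = 2 * y + 2 * y by ring, zpow_add₀ ht]
    ring
  | succ c hc ih =>
    intro hd hX hX'
    rw [ih (by omega) (fun i hi hi' => hX i hi (by omega)) (fun i hi hi' => hX' i hi (by omega)),
      hX' c hc (by omega), sub_self, mul_zero, add_zero]
    have hXc := hX c hc (by omega)
    have hXc1 := hX (c + 1) (by omega) (by omega)
    have a2 := FS_pascal (d := d) (s := s) ht hq (P := fun x => P x + sZ c x)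
      (U := fun x => X x + eZ (c + 1) x - eZ c x) (c + 1) (by omega)
      (by omega) (by simp [eZ]; omega) (2 * (X (c + 1) - eZ s (c + 1)))
      (fun x => X x - eZ c x - eZ (c + 1) x)
      (fun x => P x + sZ (c + 1) x) (fun x => X x + eZ (c + 1 + 1) x - eZ (c + 1) x)
      (by simp [eZ] at *) (by intro x _ _; simp only [eZ]; split_ifs <;> omega)
      (by intro x _ _; simp only [eZ, sZ]; split_ifs <;> omega)
      (by intro x _ _; simp only [eZ]; split_ifs <;> omega)
    have a3 := FS_pascal (d := d) (s := s) ht hq (P := fun x => P x + sZ (c + 1 - 1) x)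
      (U := fun x => X x + eZ (c + 1 - 1) x - eZ (c + 1) x) c (by omega)
      (by omega) (by simp [eZ]; omega) 0
      (fun x => X x - eZ c x - eZ (c + 1) x)
      (fun x => P x + sZ (c - 1) x) (fun x => X x + eZ (c - 1) x - eZ c x)
      (by have := hX' c hc (by omega); simp only [eZ] at *; simp; omega)
      (by intro x _ _; simp only [eZ]; split_ifs <;> omega)
      (by intro x _ _; simp only [eZ, sZ]; split_ifs <;> omega)
      (by intro x _ _; simp only [eZ]; split_ifs <;> omega)
    have a4 : FS d s t (fun x => P x + sZ (c + 1 - 1) x) (fun x => X x - eZ c x - eZ (c + 1) x)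
        = FS d s t (fun x => P x + sZ c x) (fun x => X x - eZ c x - eZ (c + 1) x) :=
      FS_congr _ _ _ (by intro x _ _; simp) (fun _ _ _ => rfl)
    rw [a3, a4, a2, zpow_add₀ ht, zpow_zero]
    ring

/-- parity vector -/
def Pc (s c x : ℤ) : ℤ := max s x + max c x

/-- the fermionic sums `F_c(L)`. -/
def Fc (d : ℕ) (s : ℤ) (t : K) (c L : ℤ) : K :=
  FS d s t (Pc s c) (fun x => L * eZ 1 x + eZ s x + eZ c x)

lemma Fc_rec {d : ℕ} {s : ℤ} {t : K} (ht : t ≠ 0) (hq : ∀ n, qp t n ≠ 0)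
    (c L : ℤ) (hc : 2 ≤ c) (hcd : c ≤ d) (hL : 1 ≤ L) :
    Fc d s t c L = (1 - t ^ (4 * (L - 1))) * Fc d s t c (L - 2)
      + t ^ (2 * (L - 1)) * Fc d s t (c - 1) (L - 1) + t ^ (2 * L) * Fc d s t (c + 1) (L - 1) := by
  have h := FS_T (d := d) (s := s) ht hq (Pc s c) (fun x => (L - 1) * eZ 1 x + eZ s x + eZ c x)
    (L - 1) (by simp only [eZ]; split_ifs <;> omega) (by simp only [eZ]; split_ifs <;> omega)
    c hc hcd (by intro i _ _; simp only [eZ]; split_ifs <;> omega)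
    (by intro i _ _; simp only [eZ]; split_ifs <;> omega)
  have e : 2 * (L - 1) + 2 * (((L - 1) * eZ 1 c + eZ s c + eZ c c) - eZ s c) = 2 * L := by
    simp only [eZ]; split_ifs <;> omega
  rw [e] at h
  unfold Fc
  refine Eq.trans ?_ (h.trans ?_)
  · exact FS_congr _ _ _ (by simp) (by intro x _ _; ring)
  · congr 1
    · congr 1
      · congr 1
        exact FS_congr _ _ _ (by simp) (by intro x _ _; ring)
      · congr 1
        exact FS_congr _ _ _ (by intro x _ _; simp only [Pc, sZ]; split_ifs <;> omega)
          (by intro x _ _; ring)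
    · congr 1
      exact FS_congr _ _ _ (by intro x _ _; simp only [Pc, sZ]; split_ifs <;> omega)
          (by intro x _ _; ring)

lemma Fc_rec_one {d : ℕ} {s : ℤ} {t : K} (ht : t ≠ 0) (hq : ∀ n, qp t n ≠ 0)
    (L : ℤ) (hd : 1 ≤ d) (hL : 0 ≤ L) :
    Fc d s t 1 L = Fc d s t 1 (L - 2) + t ^ (2 * L) * Fc d s t 2 (L - 1) := by
  unfold Fc
  exact FS_pascal (d := d) (s := s) ht hq 1 le_rfl (by omega)
    (by simp only [eZ]; split_ifs <;> omega) _ _ _ _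
    (by simp only [eZ]; split_ifs <;> omega)
    (by intro x _ _; ring)
    (by intro x _ _; simp only [Pc, eZ]; split_ifs <;> omega)
    (by intro x _ _; rw [show eZ (1 - 1) x = 0 by simp [eZ]; omega, show (1 : ℤ) + 1 = 2 by rfl]
        ring)

lemma Fc_rec_last {d : ℕ} {s : ℤ} {t : K} (ht : t ≠ 0) (hq : ∀ n, qp t n ≠ 0)
    (L : ℤ) (hd : 1 ≤ d) (hL : 1 ≤ L) :
    Fc d s t (d + 1) L = (1 - t ^ (4 * (L - 1))) * Fc d s t (d + 1) (L - 2)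
      + t ^ (2 * (L - 1)) * Fc d s t d (L - 1) := by
  rcases Nat.lt_or_ge 1 d with h2 | h2
  · have h := FS_T (d := d) (s := s) ht hq (Pc s (d + 1)) (fun x => (L - 1) * eZ 1 x + eZ s x)
      (L - 1) (by simp only [eZ]; split_ifs <;> omega) (by simp only [eZ]; split_ifs <;> omega)
      d (by omega) (by omega) (by intro i _ _; simp only [eZ]; split_ifs <;> omega)
      (by intro i _ _; simp only [eZ]; split_ifs <;> omega)
    have e : 2 * (L - 1) + 2 * (((L - 1) * eZ 1 d + eZ s d) - eZ s d) = 2 * (L - 1) := by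
      simp only [eZ]; split_ifs <;> omega
    rw [e] at h
    have h' := FS_pascal (d := d) (s := s) ht hq (P := Pc s d)
      (U := fun x => (L - 1) * eZ 1 x + eZ s x + eZ d x) d (by omega) (by omega)
      (by simp only [eZ]; split_ifs <;> omega) 0
      (fun x => (L - 1) * eZ 1 x + eZ s x + eZ (d + 1) x - eZ d x)
      (fun x => Pc s (d + 1) x + sZ (d - 1) x)
      (fun x => (L - 1) * eZ 1 x + eZ s x + eZ (d - 1) x - eZ d x)
      (by simp only [eZ]; split_ifs <;> omega)
      (by intro x _ _; rw [show eZ (d + 1) x = 0 by simp [eZ]; omega]; ring)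
      (by intro x _ _; simp only [Pc, sZ, eZ]; split_ifs <;> omega)
      (by intro x _ _; rw [show eZ (d + 1) x = 0 by simp [eZ]; omega]; ring)
    have h3 : FS d s t (Pc s d) (fun x => (L - 1) * eZ 1 x + eZ s x + eZ (d + 1) x - eZ d x)
      = FS d s t (fun x => Pc s (d + 1) x + sZ d x)
        (fun x => (L - 1) * eZ 1 x + eZ s x + eZ (d + 1) x - eZ d x) :=
      FS_congr _ _ _ (by intro x _ _; simp only [Pc, sZ]; split_ifs <;> omega) (fun _ _ _ => rfl)
    unfold Fc
    rw [h', h3, zpow_zero, one_mul, mul_add]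
    refine Eq.trans ?_ (h.trans ?_)
    · exact FS_congr _ _ _ (by simp) (by
        intro x _ _; rw [show eZ (d + 1) x = 0 by simp [eZ]; omega]; ring)
    · rw [add_assoc, add_comm (t ^ (2 * (L - 1)) * _)]
      congr 2
      exact FS_congr _ _ _ (by simp) (by
        intro x _ _; rw [show eZ (d + 1) x = 0 by simp [eZ]; omega]; ring)
  · obtain rfl : d = 1 := by omega
    have h := FS_pascal (d := 1) (s := s) ht hq (P := Pc s 2)
      (U := fun x => L * eZ 1 x + eZ s x + eZ 2 x) 1 (by omega) (by simp)
      (by simp only [eZ]; split_ifs <;> omega) (2 * (L - 1))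
      (fun x => (L - 2) * eZ 1 x + eZ s x + eZ 2 x) (Pc s 1)
      (fun x => (L - 3) * eZ 1 x + eZ s x + eZ 1 x)
      (by simp only [eZ]; split_ifs <;> omega)
      (by intro x _ _; ring)
      (by intro x _ _; simp only [Pc, eZ]; split_ifs <;> omega)
      (by intro x _ _; obtain rfl : x = 1 := by omega
          simp [eZ]; ring)
    have h' := FS_pascal (d := 1) (s := s) ht hq (P := Pc s 1)
      (U := fun x => (L - 1) * eZ 1 x + eZ s x + eZ 1 x) 1 (by omega) (by simp)
      (by simp only [eZ]; split_ifs <;> omega) (2 * (L - 1))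
      (fun x => (L - 3) * eZ 1 x + eZ s x + eZ 1 x) (Pc s 2)
      (fun x => (L - 2) * eZ 1 x + eZ s x + eZ 2 x)
      (by simp only [eZ]; split_ifs <;> omega)
      (by intro x _ _; ring)
      (by intro x _ _; simp only [Pc, eZ]; split_ifs <;> omega)
      (by intro x _ _; obtain rfl : x = 1 := by omega
          simp [eZ]; ring)
    unfold Fc
    rw [show (((1 : ℕ) : ℤ) + 1) = 2 by norm_num, show (((1 : ℕ) : ℤ)) = 1 by norm_num, h, h',
      show 4 * (L - 1) = 2 * (L - 1) + 2 * (L - 1) by ring, zpow_add₀ ht]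
    ring


lemma cv_up (M : ℤ → ℤ) (lo e : ℤ) (he : M (lo + 1) - M lo ≥ e) (he0 : 0 ≤ e) (x : ℤ)
    (hx : lo + 1 ≤ x) : (∀ y, lo < y → y < x → 2 * M y ≤ M (y - 1) + M (y + 1)) →
    M x - M (x - 1) ≥ e ∧ M x ≥ M lo + e := by
  induction x, hx using Int.leInduction with
  | base => intro _; simp only [add_sub_cancel_right]; omega
  | succ x hx ih =>
    intro h
    have h1 := ih (fun y hy hy' => h y hy (by omega))
    have h2 := h x (by omega) (by omega)
    simp only [add_sub_cancel_right]
    omega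

lemma cv_down (M : ℤ → ℤ) (hi lo : ℤ) (he : M hi - M (hi - 1) ≤ 0) 
    (hx : lo ≤ hi - 1) (h : ∀ y, lo < y → y < hi → 2 * M y ≤ M (y - 1) + M (y + 1)) :
    M hi ≤ M lo := by
  have := cv_up (fun x => M (-x)) (-hi) 0 (by
    simp only [neg_neg, neg_add, ← sub_eq_add_neg]; omega) le_rfl (-lo) (by omega) (by
    intro y h1 h2
    have := h (-y) (by omega) (by omega)
    simp only [neg_sub, neg_add]
    rw [show (1 : ℤ) - y = -y + 1 by ring, show -y + -1 = -y - 1 by ring]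
    omega)
  simp only [neg_neg] at this
  omega

lemma cv_zero (M : ℤ → ℤ) (hM : ∀ x, 0 ≤ M x) (lo hi : ℤ) (h0 : M lo = 0) (h1 : M hi = 0)
    (x : ℤ) (hx : lo ≤ x)
    (h : ∀ y, lo < y → y < hi → 2 * M y ≤ M (y - 1) + M (y + 1)) : x ≤ hi → M x = 0 := by
  induction x, hx using Int.leInduction with
  | base => intro _; exact h0
  | succ x hx ih =>
    intro hxh
    have h2 := ih (by omega)
    by_contra hne
    have h3 := hM (x + 1)
    have := cv_up M x 1 (by omega) (by norm_num) hi (by omega)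
      (fun y hy hy' => h y (by omega) hy')
    omega

lemma cv_main (M : ℤ → ℤ) (hM : ∀ x, 0 ≤ M x) (n s c : ℤ) (hs : 0 ≤ s) (hsc : s ≤ c) (hc : c ≤ n)
    (h0 : M 0 = 0) (hn : M n = 0)
    (hp : ∀ x, 0 ≤ x → x ≤ n → (M x - (max s x + max c x)) % 2 = 0)
    (h : ∀ y, 0 < y → y < n → 2 * M y ≤ M (y - 1) + M (y + 1) + eZ s y + eZ c y) :
    s = c ∧ ∀ x, 0 ≤ x → x ≤ n → M x = 0 := by
  have hcv : ∀ y, 0 < y → y < n → y ≠ s → y ≠ c → 2 * M y ≤ M (y - 1) + M (y + 1) := by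
    intro y a1 a2 a3 a4
    have := h y a1 a2
    simpa [eZ, a3, a4] using this
  -- after c
  have hafter : M c ≥ 1 → c < n → M (c + 1) - M c ≥ 0 → False := by
    intro h1 h2 h3
    have := cv_up M c 0 h3 le_rfl n (by omega)
      (fun y a1 a2 => hcv y (by omega) a2 (by omega) (by omega))
    omega
  have hbefore : 1 ≤ s → M s ≥ 1 → M s - M (s - 1) ≥ 2 := by
    intro h1 h2
    by_contra h3
    have p1 := hp s (by omega) (by omega)
    have p2 := hp (s - 1) (by omega) (by omega)
    have := cv_down M s 0 (by omega) (by omega)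
      (fun y a1 a2 => hcv y (by omega) (by omega) (by omega) (by omega))
    omega
  rcases hsc.lt_or_eq with hlt | rfl
  · exfalso
    have p1 := hp s (by omega) (by omega)
    have p2 := hp (s + 1) (by omega) (by omega)
    have hD : M (s + 1) - M s ≥ 1 := by
      by_cases hs0 : M s = 0
      · have := hM (s + 1)
        omega
      · have h1 : 1 ≤ s := by
          by_contra hh
          obtain rfl : s = 0 := by omega
          exact hs0 h0
        have := hM s
        have h2 := hbefore h1 (by omega)
        have h3 := h s (by omega) (by omega)
        simp only [eZ, if_true, if_neg hlt.ne] at h3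
        omega
    have h4 := cv_up M s 1 hD (by norm_num) c (by omega)
      (fun y a1 a2 => hcv y (by omega) (by omega) (by omega) (by omega))
    have h5 := hM s
    have hcn : c < n := by
      by_contra hh
      obtain rfl : c = n := by omega
      omega
    have h6 := h c (by omega) hcn
    simp only [eZ, if_true, if_neg hlt.ne'] at h6
    exact hafter (by omega) hcn (by omega)
  · refine ⟨rfl, ?_⟩
    have hs0 : M s = 0 := by
      by_contra hne
      have h5 := hM s
      have hsn : s < n := by
        by_contra hh
        obtain rfl : s = n := by omega
        omega
      have h1 : 1 ≤ s := by
        by_contra hh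
        obtain rfl : s = 0 := by omega
        exact hne h0
      have h2 := hbefore h1 (by omega)
      have h6 := h s (by omega) hsn
      simp only [eZ, if_true] at h6
      exact hafter (by omega) hsn (by omega)
    intro x hx hxn
    rcases le_or_gt x s with h1 | h1
    · exact cv_zero M hM 0 s h0 hs0 x hx
        (fun y a1 a2 => hcv y (by omega) (by omega) (by omega) (by omega)) h1
    · exact cv_zero M hM s n hs0 hn x h1.le
        (fun y a1 a2 => hcv y (by omega) (by omega) (by omega) (by omega)) hxn

/-- extension of `m` by zero. -/
def extM {d : ℕ} (m : Fin d → ℕ) (x : ℤ) : ℤ :=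
  if h : 1 ≤ x ∧ x ≤ d then (m ⟨(x - 1).toNat, by omega⟩ : ℤ) else 0

lemma extM_succ {d : ℕ} (m : Fin d → ℕ) (i : Fin d) : extM m ((i : ℕ) + 1 : ℤ) = m i := by
  have := i.2
  unfold extM
  rw [dif_pos (by omega)]
  congr 2
  ext
  simp

lemma fT_zero_ne {d : ℕ} {s c : ℤ} {t : K} (hs : 0 ≤ s) (hs' : s ≤ d + 1) (hc : 0 ≤ c)
    (hc' : c ≤ d + 1) (hsc : (s + c) % 2 = 0) (m : Fin d → ℕ)
    (h : fT d s t (Pc s c) (fun x => eZ s x + eZ c x) m ≠ 0) : s = c ∧ m = 0 := by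
  obtain ⟨h1, h2⟩ := fT_ne h
  have hM0 : ∀ x, 0 ≤ extM m x := by
    intro x; unfold extM; split_ifs <;> simp
  have e0 : extM m 0 = 0 := by simp [extM]
  have e1 : extM m (d + 1) = 0 := by unfold extM; rw [dif_neg (by omega)]
  have hp : ∀ x, 0 ≤ x → x ≤ (d + 1 : ℤ) → (extM m x - (max s x + max c x)) % 2 = 0 := by
    intro x hx hx'
    by_cases hxx : 1 ≤ x ∧ x ≤ d
    · have := h1 ⟨(x - 1).toNat, by omega⟩
      simp only [Pc] at this
      rw [extM, dif_pos hxx]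
      have e : (((x - 1).toNat : ℕ) : ℤ) + 1 = x := by omega
      rw [e] at this
      exact this
    · rw [extM, dif_neg hxx]; omega
  have hcv : ∀ y, 0 < y → y < (d + 1 : ℤ) →
      2 * extM m y ≤ extM m (y - 1) + extM m (y + 1) + eZ s y + eZ c y := by
    intro y hy hy'
    have hi := (h2 ⟨(y - 1).toNat, by omega⟩).2
    have e : (((y - 1).toNat : ℕ) : ℤ) + 1 = y := by omega
    have hs := inc_sum d ⟨(y - 1).toNat, by omega⟩ (extM m) e0 e1
    simp only [extM_succ] at hs
    rw [hs, ← extM_succ] at hi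
    simp only [e] at hi
    rw [show (((y - 1).toNat : ℕ) : ℤ) + 2 = y + 1 by omega,
      show (((y - 1).toNat : ℕ) : ℤ) = y - 1 by omega] at hi
    linarith
  have hfin : ∀ s' c' : ℤ, 0 ≤ s' → s' ≤ c' → c' ≤ d + 1 →
      (∀ x, 0 ≤ x → x ≤ (d + 1 : ℤ) → (extM m x - (max s' x + max c' x)) % 2 = 0) →
      (∀ y, 0 < y → y < (d + 1 : ℤ) →
      2 * extM m y ≤ extM m (y - 1) + extM m (y + 1) + eZ s' y + eZ c' y) → s' = c' ∧ m = 0 := by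
    intro s' c' a1 a2 a3 a4 a5
    obtain ⟨b1, b2⟩ := cv_main (extM m) hM0 (d + 1) s' c' a1 a2 a3 e0 e1 a4 a5
    refine ⟨b1, funext fun i => ?_⟩
    have := b2 ((i : ℕ) + 1) (by omega) (by have := i.2; omega)
    rw [extM_succ] at this
    simpa using this
  rcases le_total s c with hle | hle
  · exact hfin s c hs hle hc' hp hcv
  · obtain ⟨b1, b2⟩ := hfin c s hc hle hs' (fun x a b => by rw [add_comm (max c x)]; exact hp x a b)
      (fun y a b => by have := hcv y a b; linarith)
    exact ⟨b1.symm, b2⟩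

lemma FS_init {d : ℕ} {s c : ℤ} {t : K} (hq : ∀ n, qp t n ≠ 0) (hs : 0 ≤ s) (hs' : s ≤ d + 1)
    (hc : 0 ≤ c) (hc' : c ≤ d + 1) (hsc : (s + c) % 2 = 0) :
    FS d s t (Pc s c) (fun x => eZ s x + eZ c x) = if s = c then 1 else 0 := by
  unfold FS
  have h0 : ∀ m, m ≠ 0 → fT d s t (Pc s c) (fun x => eZ s x + eZ c x) m = 0 := by
    intro m hm
    by_contra h
    exact hm (fT_zero_ne hs hs' hc hc' hsc m h).2
  rw [finsum_eq_single _ 0 h0]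
  split_ifs with h
  · subst h
    unfold fT
    rw [if_pos (by intro i; simp only [Pc, Pi.zero_apply, Nat.cast_zero]; omega)]
    have : quadC d 0 - 2 * mAt d 0 s = 0 := by simp [quadC, mAt]
    rw [this, zpow_zero, one_mul]
    apply Finset.prod_eq_one
    intro i _
    have : ∑ k, inc d i k * (((0 : Fin d → ℕ) k : ℕ) : ℤ) = 0 := by simp
    rw [this, gaussHalf, if_pos (by simp only [eZ]; split_ifs <;> simp)]
    simp only [Pi.zero_apply]
    have h1 : 0 ≤ (0 + (eZ s ((i : ℕ) + 1) + eZ s ((i : ℕ) + 1))) / 2 := by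
      simp only [eZ]; split_ifs <;> simp
    unfold gauss
    rw [if_pos ⟨by simp, by simpa using h1⟩]
    have := hq ((0 + (eZ s ((i : ℕ) + 1) + eZ s ((i : ℕ) + 1))) / 2).toNat
    simp only [Nat.cast_zero, sub_zero, Int.toNat_zero]
    rw [show qp t 0 = 1 by simp [qp], one_mul, div_self this]
  · by_contra h'
    exact h (fT_zero_ne hs hs' hc hc' hsc 0 h').1

/-- bosonic weight. -/
def wB (t : K) (L x : ℤ) : K := t ^ (x * (x - 1)) * gauss t L ((L + x) / 2)

lemma gauss_rq (t : K) {N : ℤ} (hN : 0 ≤ N) (m : ℤ) :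
    gauss t N m = qp t N.toNat * (rq t m * rq t (N - m)) := by
  obtain ⟨n, rfl⟩ := Int.eq_ofNat_of_zero_le hN
  rw [gauss_nat]; simp

lemma gauss_symm (t : K) (N m : ℤ) : gauss t N (N - m) = gauss t N m := by
  rcases lt_or_ge N 0 with h | h
  · rw [gauss_neg t _ h, gauss_neg t _ h]
  · rw [gauss_rq t h, gauss_rq t h, sub_sub_cancel, mul_comm (rq t m)]

lemma gauss_zero (t : K) (m : ℤ) : gauss t 0 m = if m = 0 then 1 else 0 := by
  unfold gauss
  by_cases h : m = 0
  · subst h; simp [qp]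
  · rw [if_neg h, if_neg (by omega)]

lemma wB_rec {t : K} (ht : t ≠ 0) (hq : ∀ n, qp t n ≠ 0) (L x : ℤ) (hL : 1 ≤ L)
    (hx : (L + x) % 2 = 0) :
    wB t L x = t ^ (2 * (L - 1)) * wB t (L - 1) (x - 1) + t ^ (2 * L) * wB t (L - 1) (x + 1)
      + (1 - t ^ (4 * (L - 1))) * wB t (L - 2) x := by
  obtain ⟨k, hk⟩ : ∃ k, L + x = 2 * k := ⟨(L + x) / 2, by omega⟩
  obtain rfl : x = 2 * k - L := by omega
  unfold wB
  rw [show (L + (2 * k - L)) / 2 = k by omega, show (L - 1 + (2 * k - L - 1)) / 2 = k - 1 by omega,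
    show (L - 1 + (2 * k - L + 1)) / 2 = k by omega, show (L - 2 + (2 * k - L)) / 2 = k - 1 by omega]
  rw [← mul_assoc, ← mul_assoc, ← zpow_add₀ ht, ← zpow_add₀ ht,
    show 2 * (L - 1) + (2 * k - L - 1) * (2 * k - L - 1 - 1)
      = (2 * k - L) * (2 * k - L - 1) + 4 * (L - k) by ring,
    show 2 * L + (2 * k - L + 1) * (2 * k - L + 1 - 1)
      = (2 * k - L) * (2 * k - L - 1) + 4 * k by ring, zpow_add₀ ht, zpow_add₀ ht]
  suffices h : gauss t L k = t ^ (4 * (L - k)) * gauss t (L - 1) (k - 1)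
      + t ^ (4 * k) * gauss t (L - 1) k + (1 - t ^ (4 * (L - 1))) * gauss t (L - 2) (k - 1) by
    rw [h]; ring
  have a1 := rq_step (t := t) hq k
  have a2 := rq_step (t := t) hq (L - k)
  have e4 : t ^ (4 * L) = t ^ (4 * k) * t ^ (4 * (L - k)) := by
    rw [← zpow_add₀ ht]; congr 1; ring
  have hqL : qp t L.toNat = qp t (L - 1).toNat * (1 - t ^ (4 * L)) := by
    obtain ⟨n, hn⟩ : ∃ n : ℕ, L = n + 1 := ⟨(L - 1).toNat, by omega⟩
    subst hn
    rw [show ((n : ℤ) + 1).toNat = n + 1 by omega, show ((n : ℤ) + 1 - 1).toNat = n by omega, qp_succ]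
    norm_cast
  rw [gauss_rq t (show 0 ≤ L by omega), gauss_rq t (show 0 ≤ L - 1 by omega),
    gauss_rq t (show 0 ≤ L - 1 by omega), show L - 1 - (k - 1) = L - k by ring,
    show L - 1 - k = L - k - 1 by ring, ← a1, ← a2, hqL, e4]
  rcases hL.eq_or_lt with rfl | hL2
  · rw [show (1 : ℤ) - 1 = 0 by ring, mul_zero, zpow_zero, sub_self, zero_mul, add_zero]
    have h1 : (1 - t ^ (4 * k)) * (1 - t ^ (4 * (1 - k))) * (rq t k * rq t (1 - k)) = 0 := by
      have : (1 - t ^ (4 * k)) * (1 - t ^ (4 * (1 - k))) * (rq t k * rq t (1 - k))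
        = rq t (k - 1) * rq t (1 - k - 1) := by rw [← a1, ← a2]; ring
      rw [this]
      rcases lt_or_ge k 1 with h | h
      · rw [rq_neg t (show k - 1 < 0 by omega), zero_mul]
      · rw [rq_neg t (show 1 - k - 1 < 0 by omega), mul_zero]
    linear_combination qp t (0 : ℤ).toNat * h1
  · have hqL1 : qp t (L - 1).toNat = qp t (L - 2).toNat * (1 - t ^ (4 * (L - 1))) := by
      obtain ⟨n, hn⟩ : ∃ n : ℕ, L = n + 2 := ⟨(L - 2).toNat, by omega⟩
      subst hn
      rw [show ((n : ℤ) + 2 - 1) = n + 1 by ring, show ((n : ℤ) + 1).toNat = n + 1 by omega,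
        show ((n : ℤ) + 2 - 2).toNat = n by omega, qp_succ]
      norm_cast
    rw [gauss_rq t (show 0 ≤ L - 2 by omega), show L - 2 - (k - 1) = L - k - 1 by ring,
      ← a1, ← a2, hqL1]
    ring

lemma wB_top {t : K} (ht : t ≠ 0) (hq : ∀ n, qp t n ≠ 0) (L x : ℤ) (hL : 1 ≤ L)
    (hx : (L + x) % 2 = 0) :
    wB t L x = t ^ (2 * L) * wB t (L - 1) (x + 1)
      + t ^ (x * (x - 1)) * gauss t (L - 1) ((L + x) / 2 - 1) := by
  obtain ⟨k, hk⟩ : ∃ k, L + x = 2 * k := ⟨(L + x) / 2, by omega⟩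
  obtain rfl : x = 2 * k - L := by omega
  unfold wB
  rw [show (L + (2 * k - L)) / 2 = k by omega, show (L - 1 + (2 * k - L + 1)) / 2 = k by omega]
  rw [← mul_assoc, ← zpow_add₀ ht,
    show 2 * L + (2 * k - L + 1) * (2 * k - L + 1 - 1)
      = (2 * k - L) * (2 * k - L - 1) + 4 * k by ring, zpow_add₀ ht]
  have h := gauss_pascal ht hq L (L - k) (by omega)
  rw [gauss_symm, show L - k = L - 1 - (k - 1) by ring, gauss_symm,
    show L - 1 - (k - 1) - 1 = L - 1 - k by ring, gauss_symm,
    show L - (L - 1 - (k - 1)) = k by ring] at h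
  rw [h]; ring

lemma wB_ne {t : K} {L x : ℤ} (h : wB t L x ≠ 0) : -L ≤ x ∧ x ≤ L + 1 := by
  unfold wB gauss at h
  by_contra hc
  rw [if_neg (by omega)] at h
  simp at h

/-- coefficient exponents -/
def cB (r a j : ℤ) : ℤ := -4 * j * a - 4 * r * j ^ 2 + 2 * r * j

/-- bosonic summand -/
def tB (t : K) (r a b L j : ℤ) : K :=
  t ^ cB r a j * wB t L (a + 2 * r * j - b)
    - t ^ (cB r a j - 2 * a - 4 * r * j) * wB t L (-a - 2 * r * j - b)

/-- bosonic sum -/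
def BB (t : K) (r a b L : ℤ) : K := ∑ᶠ j, tB t r a b L j

lemma fin_aux {r a b L : ℤ} (hr : 1 ≤ r) :
    {j : ℤ | -L ≤ a + 2 * r * j + b ∧ a + 2 * r * j + b ≤ L + 1}.Finite := by
  apply (Set.finite_Icc (-(|L| + |a| + |b| + 1)) (|L| + |a| + |b| + 1)).subset
  rintro j ⟨h1, h2⟩
  have := le_abs_self L
  have := le_abs_self a
  have := le_abs_self b
  have := neg_abs_le L
  have := neg_abs_le a
  have := neg_abs_le b
  constructor <;> by_contra hh
  · have : 2 * r * j ≤ 2 * j := by nlinarith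
    omega
  · have : 2 * r * j ≥ 2 * j := by nlinarith
    omega

lemma supp1 {t : K} {r a b L : ℤ} (hr : 1 ≤ r) (c : ℤ → K) :
    (Function.support fun j : ℤ => c j * wB t L (a + 2 * r * j - b)).Finite := by
  apply (fin_aux (a := a) (b := -b) (L := L) hr).subset
  intro j hj
  have := wB_ne (right_ne_zero_of_mul hj)
  constructor <;> omega

lemma supp2 {t : K} {r a b L : ℤ} (hr : 1 ≤ r) (c : ℤ → K) :
    (Function.support fun j : ℤ => c j * wB t L (-a - 2 * r * j - b)).Finite := by
  apply (fin_aux (a := a) (b := b) (L := |L| + 1) hr).subset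
  intro j hj
  have := wB_ne (right_ne_zero_of_mul hj)
  have := le_abs_self L
  constructor <;> omega

lemma tB_supp {t : K} {r a b L : ℤ} (hr : 1 ≤ r) :
    (Function.support fun j : ℤ => tB t r a b L j).Finite := by
  unfold tB
  refine ((supp1 hr _).union (supp2 hr _)).subset (Function.support_sub _ _)

lemma BB_rec {t : K} (ht : t ≠ 0) (hq : ∀ n, qp t n ≠ 0) {r a b L : ℤ} (hr : 1 ≤ r) (hL : 1 ≤ L)
    (hp : (L + a + b) % 2 = 0) :
    BB t r a b L = t ^ (2 * (L - 1)) * BB t r a (b + 1) (L - 1)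
      + t ^ (2 * L) * BB t r a (b - 1) (L - 1) + (1 - t ^ (4 * (L - 1))) * BB t r a b (L - 2) := by
  unfold BB
  have f : ∀ (c : K) b' L', (Function.support fun j : ℤ => c * tB t r a b' L' j).Finite := by
    intro c b' L'
    exact (tB_supp (t := t) (a := a) (b := b') (L := L') hr).subset
      (fun j hj => right_ne_zero_of_mul hj)
  rw [mul_finsum' _ _ (tB_supp hr), mul_finsum' _ _ (tB_supp hr), mul_finsum' _ _ (tB_supp hr),
    ← finsum_add_distrib (f _ _ _) (f _ _ _), ← finsum_add_distrib ?_ (f _ _ _)]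
  · apply finsum_congr
    intro j
    unfold tB
    have e : 2 * r * j = 2 * (r * j) := by ring
    rw [wB_rec ht hq L (a + 2 * r * j - b) hL (by omega),
      wB_rec ht hq L (-a - 2 * r * j - b) hL (by omega)]
    rw [show a + 2 * r * j - b - 1 = a + 2 * r * j - (b + 1) by ring,
      show a + 2 * r * j - b + 1 = a + 2 * r * j - (b - 1) by ring,
      show -a - 2 * r * j - b - 1 = -a - 2 * r * j - (b + 1) by ring,
      show -a - 2 * r * j - b + 1 = -a - 2 * r * j - (b - 1) by ring]
    ring
  · exact ((f _ _ _).union (f _ _ _)).subset (Function.support_add _ _)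

lemma BB_b0 {t : K} (ht : t ≠ 0) {r a L : ℤ} (hp : (L + a) % 2 = 0) : BB t r a 0 L = 0 := by
  unfold BB
  refine finsum_eq_zero_of_forall_eq_zero fun j => ?_
  unfold tB wB
  have e : 2 * r * j = 2 * (r * j) := by ring
  rw [show (L + (a + 2 * r * j - 0)) / 2 = L - (L + (-a - 2 * r * j - 0)) / 2 by omega, gauss_symm,
    ← mul_assoc, ← mul_assoc, ← zpow_add₀ ht, ← zpow_add₀ ht, sub_eq_zero]
  congr 2
  ring

lemma BB_L0 {t : K} {r a b : ℤ} (ha : 1 ≤ a) (ha' : a ≤ r - 1) (hb : 0 ≤ b) (hb' : b ≤ r - 1)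
    (hp : (a + b) % 2 = 0) : BB t r a b 0 = if a = b then 1 else 0 := by
  unfold BB
  have hw : ∀ x, x % 2 = 0 → wB t 0 x = if x = 0 then 1 else 0 := by
    intro x hx
    unfold wB
    rw [gauss_zero]
    by_cases h : x = 0
    · subst h; simp
    · rw [if_neg (by omega), if_neg h, mul_zero]
  have ht : ∀ j, tB t r a b 0 j = if j = 0 then (if a = b then 1 else 0) else 0 := by
    intro j
    have e : 2 * r * j = 2 * (r * j) := by ring
    unfold tB
    rw [hw _ (by omega), hw _ (by omega)]
    rcases lt_trichotomy j 0 with h | h | h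
    · have : r * j ≤ -r := by nlinarith
      rw [if_neg (by omega), if_neg (by omega), if_neg (by omega)]; simp
    · subst h
      rw [if_neg (show ¬ (-a - 2 * r * 0 - b = 0) by omega), if_pos rfl]
      by_cases hab : a = b
      · rw [if_pos (by omega), if_pos hab]; simp [cB]
      · rw [if_neg (by omega), if_neg hab]; simp
    · have : r * j ≥ r := by nlinarith
      rw [if_neg (by omega), if_neg (by omega), if_neg (by omega)]; simp
  rw [finsum_congr ht, finsum_eq_single _ 0 (by intro j hj; rw [if_neg hj])]
  simp

lemma BB_top {t : K} (ht : t ≠ 0) (hq : ∀ n, qp t n ≠ 0) {r a L : ℤ} (hr : 1 ≤ r) (hL : 1 ≤ L)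
    (hp : (L + a + r - 1) % 2 = 0) :
    BB t r a (r - 1) L = t ^ (2 * L) * BB t r a (r - 2) (L - 1) := by
  set G : ℤ → K := fun x => t ^ (x * (x - 1)) * gauss t (L - 1) ((L + x) / 2 - 1) with hG
  have g1 : (Function.support fun j : ℤ => t ^ cB r a j * G (a + 2 * r * j - (r - 1))).Finite := by
    apply (fin_aux (a := a) (b := -(r - 1)) (L := |L| + 1) hr).subset
    intro j hj
    have h := right_ne_zero_of_mul (right_ne_zero_of_mul hj)
    have := le_abs_self L
    unfold gauss at h
    by_contra hc
    simp only [Set.mem_ofPred_eq, not_and_or, not_le] at hc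
    exact h (if_neg (by omega))
  have g2 : (Function.support fun j : ℤ =>
      t ^ (cB r a j - 2 * a - 4 * r * j) * G (-a - 2 * r * j - (r - 1))).Finite := by
    apply (fin_aux (a := a) (b := (r - 1)) (L := |L| + 1) hr).subset
    intro j hj
    have h := right_ne_zero_of_mul (right_ne_zero_of_mul hj)
    have := le_abs_self L
    unfold gauss at h
    by_contra hc
    simp only [Set.mem_ofPred_eq, not_and_or, not_le] at hc
    exact h (if_neg (by omega))
  have hz : ∑ᶠ j : ℤ, (t ^ cB r a j * G (a + 2 * r * j - (r - 1))
      - t ^ (cB r a j - 2 * a - 4 * r * j) * G (-a - 2 * r * j - (r - 1))) = 0 := by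
    rw [finsum_sub_distrib g1 g2, sub_eq_zero]
    rw [← finsum_comp_equiv (Equiv.subRight (1 : ℤ)) (f := fun j =>
      t ^ (cB r a j - 2 * a - 4 * r * j) * G (-a - 2 * r * j - (r - 1)))]
    apply finsum_congr
    intro j
    simp only [Equiv.subRight_apply, hG]
    have e : 2 * r * j = 2 * (r * j) := by ring
    have e' : 2 * r * (j - 1) = 2 * (r * j) - 2 * r := by ring
    rw [← mul_assoc, ← mul_assoc, ← zpow_add₀ ht, ← zpow_add₀ ht,
      show (L + (a + 2 * r * j - (r - 1))) / 2 - 1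
        = L - 1 - ((L + (-a - 2 * r * (j - 1) - (r - 1))) / 2 - 1) by omega, gauss_symm]
    congr 2
    simp only [cB]; ring
  have f : ∀ (c : K) b' L', (Function.support fun j : ℤ => c * tB t r a b' L' j).Finite := by
    intro c b' L'
    exact (tB_supp (t := t) (a := a) (b := b') (L := L') hr).subset
      (fun j hj => right_ne_zero_of_mul hj)
  unfold BB
  rw [mul_finsum' _ _ (tB_supp hr), ← add_zero (finsum fun i => t ^ (2 * L) * _), ← hz,
    ← finsum_add_distrib (f _ _ _)]
  · apply finsum_congr
    intro j
    unfold tB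
    have e : 2 * r * j = 2 * (r * j) := by ring
    rw [wB_top ht hq L (a + 2 * r * j - (r - 1)) hL (by omega),
      wB_top ht hq L (-a - 2 * r * j - (r - 1)) hL (by omega)]
    rw [show a + 2 * r * j - (r - 1) + 1 = a + 2 * r * j - (r - 2) by ring,
      show -a - 2 * r * j - (r - 1) + 1 = -a - 2 * r * j - (r - 2) by ring]
    simp only [hG]
    ring
  · exact (g1.union g2).subset (Function.support_sub _ _)

lemma Fc_d0 {s : ℤ} {t : K} (c L : ℤ) : Fc 0 s t c L = 1 := by
  unfold Fc FS
  rw [finsum_eq_single _ 0 (by intro m hm; exact absurd (Subsingleton.elim _ _) hm)]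
  simp [fT, quadC, mAt]

lemma BB_r3 {t : K} (ht : t ≠ 0) (hq : ∀ n, qp t n ≠ 0) {a : ℤ} (ha : 1 ≤ a) (ha' : a ≤ 2)
    (L : ℕ) : ((L : ℤ) + a + 1) % 2 = 0 → BB t 3 a 1 L = 1 := by
  induction L using Nat.strong_induction_on with
  | _ L ih =>
    intro hp
    rcases Nat.lt_or_ge L 1 with h | h
    · obtain rfl : L = 0 := by omega
      rw [Nat.cast_zero, BB_L0 ha (by omega) (by norm_num) (by norm_num) (by omega),
        if_pos (by omega)]
    · rw [BB_rec ht hq (by norm_num) (by omega) (by omega), show (1 : ℤ) - 1 = 0 by ring,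
        BB_b0 ht (by omega), show (1 : ℤ) + 1 = 2 by ring]
      rcases Nat.lt_or_ge L 2 with h2 | h2
      · obtain rfl : L = 1 := by omega
        have := BB_L0 (t := t) (r := 3) (a := a) (b := 2) ha (by omega) (by norm_num) (by norm_num)
          (by omega)
        rw [if_pos (by omega)] at this
        simp [this]
      · have h3 := BB_top ht hq (r := 3) (a := a) (L := (L : ℤ) - 1) (by norm_num) (by omega)
          (by omega)
        have h4 := ih (L - 2) (by omega) (by omega)
        rw [show ((L - 2 : ℕ) : ℤ) = (L : ℤ) - 2 by omega] at h4
        rw [show (3 : ℤ) - 1 = 2 by ring, show (3 : ℤ) - 2 = 1 by ring,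
          show (L : ℤ) - 1 - 1 = L - 2 by ring] at h3
        rw [h3, h4, show 4 * ((L : ℤ) - 1) = 2 * (L - 1) + 2 * (L - 1) by ring, zpow_add₀ ht]
        ring

theorem Fc_eq {d : ℕ} {s : ℤ} {t : K} (ht : t ≠ 0) (hq : ∀ n, qp t n ≠ 0) (hs : 0 ≤ s)
    (hs' : s ≤ d + 1) (L : ℕ) : ∀ c : ℤ, 1 ≤ c → c ≤ d + 1 → ((L : ℤ) + s + c) % 2 = 0 →
    Fc d s t c L = BB t (d + 3) (d + 2 - s) (d + 2 - c) L := by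
  rcases Nat.eq_zero_or_pos d with rfl | hd
  · intro c hc hc' hp
    obtain rfl : c = 1 := by simp at hc'; omega
    rw [Fc_d0]
    have := BB_r3 ht hq (a := 2 - s) (by push_cast at hs'; omega) (by omega) L (by omega)
    simp only [Nat.cast_zero, zero_add]
    exact this.symm
  induction L using Nat.strong_induction_on with
  | _ L ih =>
    intro c hc hc' hp
    have ih' : ∀ L' : ℤ, 0 ≤ L' → L' < L → ∀ c : ℤ, 1 ≤ c → c ≤ d + 1 → (L' + s + c) % 2 = 0 →
        Fc d s t c L' = BB t (d + 3) (d + 2 - s) (d + 2 - c) L' := by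
      intro L' h1 h2
      obtain ⟨l, rfl⟩ := Int.eq_ofNat_of_zero_le h1
      exact ih l (by omega)
    rcases Nat.lt_or_ge L 1 with h | h
    · obtain rfl : L = 0 := by omega
      rw [Nat.cast_zero, BB_L0 (by omega) (by omega) (by omega) (by omega) (by omega)]
      unfold Fc
      have := FS_init (d := d) (s := s) (c := c) hq hs hs' (by omega) hc' (by omega)
      rw [FS_congr d s t (P' := Pc s c) (U' := fun x => eZ s x + eZ c x) (by simp)
        (by intro x _ _; ring), this]
      exact if_congr (by omega) rfl rfl
    · have hB := BB_rec ht hq (r := d + 3) (a := d + 2 - s) (b := d + 2 - c) (L := L) (by omega)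
        (by omega) (by omega)
      rcases hc.eq_or_lt with rfl | hc2
      · rw [Fc_rec_one ht hq L hd (by omega), hB,
          ih' (L - 1) (by omega) (by omega) 2 (by omega) (by omega) (by omega),
          show (d : ℤ) + 2 - 1 - 1 = d + 2 - 2 by ring]
        rcases Nat.lt_or_ge L 2 with h2 | h2
        · obtain rfl : L = 1 := by omega
          have h3 : Fc d s t 1 (((1 : ℕ) : ℤ) - 2) = if s = 0 then 1 else 0 := by
            rw [← FS_init (d := d) (s := s) (c := 0) (t := t) hq hs hs' le_rfl (by omega)
              (by omega)]
            unfold Fc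
            refine FS_congr _ _ _ ?_ ?_
            · intro i _ _; simp only [Pc]; omega
            · intro i _ _; simp only [eZ]; push_cast; split_ifs <;> omega
          rw [h3, show (d : ℤ) + 2 - 1 + 1 = d + 2 by ring, Nat.cast_one,
            show (1 : ℤ) - 1 = 0 by ring,
            BB_L0 (b := (d : ℤ) + 2) (by omega) (by omega) (by omega) (by omega) (by omega),
            if_congr (show s = 0 ↔ (d : ℤ) + 2 - s = d + 2 by omega) rfl rfl]
          simp
        · have h3 := BB_top ht hq (r := d + 3) (a := d + 2 - s) (L := (L : ℤ) - 1) (by omega)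
            (by omega) (by omega)
          rw [show (d : ℤ) + 3 - 1 = d + 2 - 1 + 1 by ring,
            show (d : ℤ) + 3 - 2 = d + 2 - 1 by ring, show (L : ℤ) - 1 - 1 = L - 2 by ring] at h3
          rw [h3, ih' (L - 2) (by omega) (by omega) 1 (by omega) (by omega) (by omega),
            show 4 * ((L : ℤ) - 1) = 2 * (L - 1) + 2 * (L - 1) by ring, zpow_add₀ ht]
          ring
      · have hL2 : (1 - t ^ (4 * ((L : ℤ) - 1))) * Fc d s t c (L - 2)
          = (1 - t ^ (4 * ((L : ℤ) - 1))) * BB t (d + 3) (d + 2 - s) (d + 2 - c) (L - 2) := by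
          rcases Nat.lt_or_ge L 2 with h2 | h2
          · obtain rfl : L = 1 := by omega
            simp
          · rw [ih' (L - 2) (by omega) (by omega) c (by omega) (by omega) (by omega)]
        have hL1 := ih' (L - 1) (by omega) (by omega) (c - 1) (by omega) (by omega) (by omega)
        rcases hc'.eq_or_lt with rfl | hc3
        · rw [Fc_rec_last ht hq L hd (by omega), hB, hL2,
            show (d : ℤ) + 2 - (d + 1) - 1 = 0 by ring, BB_b0 ht (by omega)]
          rw [show (d : ℤ) + 1 - 1 = d by ring] at hL1
          rw [hL1, show (d : ℤ) + 2 - d = d + 2 - (d + 1) + 1 by ring]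
          ring
        · have hL0 := ih' (L - 1) (by omega) (by omega) (c + 1) (by omega) (by omega) (by omega)
          rw [Fc_rec ht hq c L (by omega) (by omega) (by omega), hB, hL2, hL1, hL0,
            show (d : ℤ) + 2 - (c - 1) = d + 2 - c + 1 by ring,
            show (d : ℤ) + 2 - (c + 1) = d + 2 - c - 1 by ring]
          ring

lemma vander {t : K} (ht : t ≠ 0) (hq : ∀ n, qp t n ≠ 0) (M : ℕ) : ∀ s : ℤ,
    ∑ i ∈ Finset.range (M + 1), t ^ (4 * ((i : ℤ) ^ 2 + s * i)) * rq t ((M : ℤ) - i) * rq t i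
      * rq t (i + s) = rq t M * rq t (M + s) := by
  induction M with
  | zero => intro s; simp [rq, qp]
  | succ M ih =>
    intro s
    have hne : (1 - t ^ (4 * ((M : ℤ) + 1))) ≠ 0 := by
      have h := hq (M + 1)
      rw [qp_succ] at h
      have := right_ne_zero_of_mul h
      exact_mod_cast this
    apply mul_left_cancel₀ hne
    have hstep := rq_step hq ((M : ℤ) + 1)
    rw [add_sub_cancel_right] at hstep
    have hstep2 := rq_step hq ((M : ℤ) + 1 + s)
    rw [show (M : ℤ) + 1 + s - 1 = M + s by ring] at hstep2
    push_cast
    rw [← mul_assoc (1 - _), hstep, Finset.mul_sum]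
    have h1 : ∀ i ∈ Finset.range (M + 1 + 1),
        (1 - t ^ (4 * ((M : ℤ) + 1))) * (t ^ (4 * ((i : ℤ) ^ 2 + s * i)) * rq t ((M : ℤ) + 1 - i)
          * rq t i * rq t (i + s))
        = t ^ (4 * ((i : ℤ) ^ 2 + s * i)) * rq t ((M : ℤ) - i) * rq t i * rq t (i + s)
          + t ^ (4 * ((i : ℤ) ^ 2 + s * i + (M + 1 - i))) * rq t ((M : ℤ) + 1 - i)
            * rq t (i - 1) * rq t (i + s) := by
      intro i _
      have a1 := rq_step hq (i : ℤ)
      have a2 := rq_step hq ((M : ℤ) + 1 - i)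
      rw [show (M : ℤ) + 1 - i - 1 = M - i by ring] at a2
      rw [← a1, ← a2, show 4 * ((i : ℤ) ^ 2 + s * i + (M + 1 - i))
        = 4 * ((i : ℤ) ^ 2 + s * i) + 4 * ((M : ℤ) + 1 - i) by ring, zpow_add₀ ht,
        show 4 * ((M : ℤ) + 1) = 4 * ((M : ℤ) + 1 - i) + 4 * i by ring, zpow_add₀ ht]
      ring
    rw [Finset.sum_congr rfl h1, Finset.sum_add_distrib, Finset.sum_range_succ,
      rq_neg t (show (M : ℤ) - ((M + 1 : ℕ) : ℤ) < 0 by push_cast; omega), ih s,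
      Finset.sum_range_succ']
    rw [rq_neg t (show ((0 : ℕ) : ℤ) - 1 < 0 by norm_num)]
    have h2 : ∀ i ∈ Finset.range (M + 1),
        t ^ (4 * (((i + 1 : ℕ) : ℤ) ^ 2 + s * (i + 1 : ℕ) + (M + 1 - (i + 1 : ℕ))))
          * rq t ((M : ℤ) + 1 - (i + 1 : ℕ)) * rq t ((i + 1 : ℕ) - 1) * rq t ((i + 1 : ℕ) + s)
        = t ^ (4 * ((M : ℤ) + 1 + s)) * (t ^ (4 * ((i : ℤ) ^ 2 + (s + 1) * i)) * rq t ((M : ℤ) - i)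
          * rq t i * rq t (i + (s + 1))) := by
      intro i _
      push_cast
      rw [show (M : ℤ) + 1 - (i + 1) = M - i by ring, show (i : ℤ) + 1 - 1 = i by ring,
        show (i : ℤ) + 1 + s = i + (s + 1) by ring,
        show 4 * (((i : ℤ) + 1) ^ 2 + s * (i + 1) + (M - i))
          = 4 * ((M : ℤ) + 1 + s) + 4 * ((i : ℤ) ^ 2 + (s + 1) * i) by ring, zpow_add₀ ht]
      ring
    rw [Finset.sum_congr rfl h2, ← Finset.mul_sum, ih (s + 1), ← hstep2,
      show (M : ℤ) + (s + 1) = M + 1 + s by ring]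
    ring

lemma bailey_step {t : K} (ht : t ≠ 0) (hq : ∀ n, qp t n ≠ 0) (M : ℕ) (J : ℤ) :
    ∑ n ∈ Finset.range (M + 1), t ^ (4 * ((n : ℤ) ^ 2 + n)) * rq t ((M : ℤ) - n)
      * (rq t (n - J) * rq t (n + J + 1))
      = t ^ (4 * (J ^ 2 + J)) * (rq t (M - J) * rq t (M + J + 1)) := by
  have key : ∀ J : ℕ, ∑ n ∈ Finset.range (M + 1), t ^ (4 * ((n : ℤ) ^ 2 + n)) * rq t ((M : ℤ) - n)
      * (rq t (n - J) * rq t (n + J + 1))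
      = t ^ (4 * ((J : ℤ) ^ 2 + J)) * (rq t (M - J) * rq t (M + J + 1)) := by
    intro J
    rcases Nat.lt_or_ge M J with h | h
    · rw [rq_neg t (show (M : ℤ) - J < 0 by omega), zero_mul, mul_zero]
      apply Finset.sum_eq_zero
      intro n hn
      rw [Finset.mem_range] at hn
      rw [rq_neg t (show (n : ℤ) - J < 0 by omega)]; ring
    · obtain ⟨m, rfl⟩ := Nat.exists_eq_add_of_le h
      rw [add_assoc, Finset.sum_range_add, Finset.sum_eq_zero, zero_add]
      · have h1 := vander ht hq m (2 * J + 1)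
        push_cast
        rw [show (J : ℤ) + m - J = m by ring, show (J : ℤ) + m + J + 1 = m + (2 * J + 1) by ring,
          ← h1, Finset.mul_sum]
        apply Finset.sum_congr rfl
        intro i _
        rw [show (J : ℤ) + m - (J + i) = m - i by ring, show (J : ℤ) + i - J = i by ring,
          show (J : ℤ) + i + J + 1 = i + (2 * J + 1) by ring,
          show 4 * (((J : ℤ) + i) ^ 2 + (J + i)) = 4 * ((J : ℤ) ^ 2 + J)
            + 4 * ((i : ℤ) ^ 2 + (2 * J + 1) * i) by ring, zpow_add₀ ht]
        ring
      · intro n hn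
        rw [Finset.mem_range] at hn
        rw [rq_neg t (show (n : ℤ) - J < 0 by omega)]; ring
  rcases le_or_gt 0 J with h | h
  · obtain ⟨j, rfl⟩ := Int.eq_ofNat_of_zero_le h
    exact key j
  · obtain ⟨j, hj⟩ : ∃ j : ℕ, J = -(j : ℤ) - 1 := ⟨(-J - 1).toNat, by omega⟩
    subst hj
    have := key j
    rw [show (-(j : ℤ) - 1) ^ 2 + (-(j : ℤ) - 1) = (j : ℤ) ^ 2 + j by ring,
      show (M : ℤ) - (-(j : ℤ) - 1) = M + j + 1 by ring,
      show (M : ℤ) + (-(j : ℤ) - 1) + 1 = M - j by ring, mul_comm (rq t _), ← this]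
    apply Finset.sum_congr rfl
    intro n _
    rw [show (n : ℤ) - (-(j : ℤ) - 1) = n + j + 1 by ring,
      show (n : ℤ) + (-(j : ℤ) - 1) + 1 = n - j by ring, mul_comm (rq t ((n : ℤ) - j))]

lemma sum_adt (k M : ℕ) (f : (Fin (k + 1) → ℕ) → K) :
    ∑ n ∈ Finset.Nat.antidiagonalTuple (k + 1) M, f n
      = ∑ i ∈ Finset.range (M + 1), ∑ n ∈ Finset.Nat.antidiagonalTuple k i,
        f (Fin.cons (M - i) n) := by
  rw [Finset.sum_sigma']
  refine Finset.sum_bij' (fun n _ => ⟨M - n 0, Fin.tail n⟩) (fun p _ => Fin.cons (M - p.1) p.2)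
    ?_ ?_ ?_ ?_ ?_
  · intro n hn
    rw [Finset.Nat.mem_antidiagonalTuple, Fin.sum_univ_succ] at hn
    simp only [Finset.mem_sigma, Finset.mem_range, Finset.Nat.mem_antidiagonalTuple, Fin.tail]
    omega
  · rintro ⟨i, n⟩ hn
    simp only [Finset.mem_sigma, Finset.mem_range, Finset.Nat.mem_antidiagonalTuple] at hn
    simp only [Finset.Nat.mem_antidiagonalTuple, Fin.sum_univ_succ, Fin.cons_zero, Fin.cons_succ]
    omega
  · intro n hn
    rw [Finset.Nat.mem_antidiagonalTuple, Fin.sum_univ_succ] at hn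
    simp only
    rw [show M - (M - n 0) = n 0 by omega, Fin.cons_self_tail]
  · rintro ⟨i, n⟩ hn
    simp only [Finset.mem_sigma, Finset.mem_range, Finset.Nat.mem_antidiagonalTuple] at hn
    simp only [Fin.cons_zero, Fin.tail_cons]
    congr 1
    omega
  · intro n hn
    rw [Finset.Nat.mem_antidiagonalTuple, Fin.sum_univ_succ] at hn
    simp only
    rw [show M - (M - n 0) = n 0 by omega, Fin.cons_self_tail]

/-- the exponent `n^T B (n + e_k)`. -/
def tadE (k : ℕ) (n : Fin k → ℕ) : ℤ :=
  tadB k (fun i => (n i : ℤ)) (fun i => (n i : ℤ) + (if (i : ℕ) + 1 = k then 1 else 0))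

/-- the denominators. -/
def denP (t : K) (k : ℕ) (n : Fin k → ℕ) : K :=
  ∏ i : Fin k, if (i : ℕ) + 1 < k then qp t (n i) else 1

lemma mAtN_cons (k : ℕ) (x : ℕ) (n : Fin (k + 1) → ℕ) :
    mAtN (k + 2) (Fin.cons x n) (k + 2) = mAtN (k + 1) n (k + 1) := by
  unfold mAtN
  rw [Fin.sum_univ_succ]
  simp

lemma denP_cons (t : K) (k : ℕ) (x : ℕ) (n : Fin (k + 1) → ℕ) :
    denP t (k + 2) (Fin.cons x n) = qp t x * denP t (k + 1) n := by
  unfold denP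
  rw [Fin.prod_univ_succ]
  simp

lemma tadB_cons (k : ℕ) (v w : Fin (k + 1) → ℤ) :
    tadB (k + 1) v w = (∑ i, v i) * (∑ i, w i)
      + tadB k (fun i => v i.succ) (fun i => w i.succ) := by
  unfold tadB
  rw [Finset.sum_mul_sum]
  have h : ∀ i l : Fin (k + 1), v i * (min ((i : ℕ) + 1) ((l : ℕ) + 1) : ℤ) * w l
      = v i * w l + v i * (min (i : ℕ) (l : ℕ) : ℤ) * w l := by
    intro i l
    rw [min_add_add_right]; ring
  simp only [h, Finset.sum_add_distrib]
  congr 1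
  rw [Fin.sum_univ_succ]
  simp only [Fin.val_zero, Nat.cast_zero]
  rw [Finset.sum_eq_zero (fun l _ => by
    rw [min_eq_left (by positivity)]; simp), zero_add]
  apply Finset.sum_congr rfl
  intro i _
  rw [Fin.sum_univ_succ, Fin.val_zero, Nat.cast_zero, min_eq_right (by positivity)]
  simp

lemma tadE_cons (k : ℕ) (x : ℕ) (n : Fin (k + 1) → ℕ) (M : ℕ) (hM : x + ∑ i, n i = M) :
    tadE (k + 2) (Fin.cons x n) = (M : ℤ) ^ 2 + M + tadE (k + 1) n := by
  unfold tadE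
  rw [tadB_cons]
  have h1 : ∑ i : Fin (k + 2), (((Fin.cons x n : Fin (k + 2) → ℕ) i : ℕ) : ℤ) = M := by
    rw [Fin.sum_univ_succ]
    simp only [Fin.cons_zero, Fin.cons_succ]
    rw [← hM]; push_cast; ring
  rw [Finset.sum_add_distrib, h1]
  have h2 : ∑ i : Fin (k + 2), (if (i : ℕ) + 1 = k + 2 then (1 : ℤ) else 0) = 1 := by
    rw [Fin.sum_univ_castSucc, Finset.sum_eq_zero]
    · simp
    · intro i _
      have := i.2
      rw [if_neg (by rw [Fin.val_castSucc]; omega)]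
  rw [h2]
  simp only [Fin.cons_succ, Fin.val_succ, add_left_inj]
  ring

theorem bailey_fin {t : K} (ht : t ≠ 0) (hq : ∀ n, qp t n ≠ 0) (J : ℤ) (k : ℕ) : ∀ M : ℕ,
    ∑ n ∈ Finset.Nat.antidiagonalTuple (k + 1) M,
      t ^ (4 * tadE (k + 1) n) * (denP t (k + 1) n)⁻¹
        * (rq t (mAtN (k + 1) n (k + 1) - J) * rq t (mAtN (k + 1) n (k + 1) + J + 1))
      = t ^ (4 * ((M : ℤ) ^ 2 + M)) * t ^ (4 * (k * (J ^ 2 + J)))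
        * (rq t (M - J) * rq t (M + J + 1)) := by
  induction k with
  | zero =>
    intro M
    rw [zero_add, Finset.Nat.antidiagonalTuple_one]
    simp [tadE, tadB, denP, mAtN]
    left; congr 1; ring
  | succ k ih =>
    intro M
    rw [sum_adt]
    have h : ∀ i ∈ Finset.range (M + 1), ∑ n ∈ Finset.Nat.antidiagonalTuple (k + 1) i,
        t ^ (4 * tadE (k + 1 + 1) (Fin.cons (M - i) n)) * (denP t (k + 1 + 1) (Fin.cons (M - i) n))⁻¹
        * (rq t (mAtN (k + 1 + 1) (Fin.cons (M - i) n) (k + 1 + 1) - J)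
          * rq t (mAtN (k + 1 + 1) (Fin.cons (M - i) n) (k + 1 + 1) + J + 1))
        = t ^ (4 * ((M : ℤ) ^ 2 + M)) * t ^ (4 * (k * (J ^ 2 + J))) *
          (t ^ (4 * ((i : ℤ) ^ 2 + i)) * rq t ((M : ℤ) - i)
      * (rq t (i - J) * rq t (i + J + 1))) := by
      intro i hi
      rw [Finset.mem_range] at hi
      have h1 : ∀ n ∈ Finset.Nat.antidiagonalTuple (k + 1) i,
        t ^ (4 * tadE (k + 1 + 1) (Fin.cons (M - i) n)) * (denP t (k + 1 + 1) (Fin.cons (M - i) n))⁻¹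
        * (rq t (mAtN (k + 1 + 1) (Fin.cons (M - i) n) (k + 1 + 1) - J)
          * rq t (mAtN (k + 1 + 1) (Fin.cons (M - i) n) (k + 1 + 1) + J + 1))
        = t ^ (4 * ((M : ℤ) ^ 2 + M)) * rq t ((M : ℤ) - i) *
          (t ^ (4 * tadE (k + 1) n) * (denP t (k + 1) n)⁻¹
        * (rq t (mAtN (k + 1) n (k + 1) - J) * rq t (mAtN (k + 1) n (k + 1) + J + 1))) := by
        intro n hn
        rw [Finset.Nat.mem_antidiagonalTuple] at hn
        rw [mAtN_cons, denP_cons, tadE_cons k (M - i) n M (by omega), mul_add, zpow_add₀ ht,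
          show (M : ℤ) - i = ((M - i : ℕ) : ℤ) by omega, rq_nat, mul_inv]
        ring
      rw [Finset.sum_congr rfl h1, ← Finset.mul_sum, ih i]
      ring
    rw [Finset.sum_congr rfl h, ← Finset.mul_sum, bailey_step ht hq,
      show 4 * (((k + 1 : ℕ) : ℤ) * (J ^ 2 + J)) = 4 * (k * (J ^ 2 + J)) + 4 * (J ^ 2 + J) by
        push_cast; ring, zpow_add₀ ht]
    ring

/-- `x` is `O(t^D)`. -/
def OrdL (D : ℤ) (x : LaurentSeries ℚ) : Prop := Valued.v x ≤ WithZero.exp (-D)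

lemma tL_zpow (n : ℤ) : Valued.v (tL ^ n) = WithZero.exp (-n) := by
  have h := LaurentSeries.valuation_single_zpow ℚ 1
  rw [map_zpow₀]
  unfold tL
  rw [h, ← WithZero.exp_zsmul]
  congr 1
  simp

lemma tL_ne : tL ≠ 0 := by
  unfold tL
  exact HahnSeries.single_ne_zero one_ne_zero

lemma ord_zpow (n : ℤ) : OrdL n (tL ^ n) := (tL_zpow n).le

lemma ord_mono {D D' : ℤ} (h : D' ≤ D) {x : LaurentSeries ℚ} (hx : OrdL D x) : OrdL D' x :=
  le_trans hx (by rw [WithZero.exp_le_exp]; omega)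

lemma ord_add {D : ℤ} {x y : LaurentSeries ℚ} (hx : OrdL D x) (hy : OrdL D y) : OrdL D (x + y) :=
  (Valuation.map_add_le _ hx hy)

lemma ord_neg {D : ℤ} {x : LaurentSeries ℚ} (hx : OrdL D x) : OrdL D (-x) := by
  unfold OrdL; rw [Valuation.map_neg]; exact hx

lemma ord_sub {D : ℤ} {x y : LaurentSeries ℚ} (hx : OrdL D x) (hy : OrdL D y) : OrdL D (x - y) := by
  rw [sub_eq_add_neg]; exact ord_add hx (ord_neg hy)

lemma ord_mul {D D' : ℤ} {x y : LaurentSeries ℚ} (hx : OrdL D x) (hy : OrdL D' y) :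
    OrdL (D + D') (x * y) := by
  unfold OrdL
  rw [map_mul, neg_add, WithZero.exp_add]
  exact mul_le_mul' hx hy

lemma ord_sum {ι : Type*} {D : ℤ} {s : Finset ι} {f : ι → LaurentSeries ℚ}
    (h : ∀ i ∈ s, OrdL D (f i)) : OrdL D (∑ i ∈ s, f i) :=
  Valuation.map_sum_le _ h

lemma ord_zero (D : ℤ) : OrdL D 0 := by simp [OrdL]

lemma ord_one : OrdL 0 1 := by simp [OrdL]

lemma ord_nhds {s : Set (LaurentSeries ℚ)} :
    s ∈ nhds (0 : LaurentSeries ℚ) ↔ ∃ D, ∀ x, OrdL D x → x ∈ s := by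
  rw [Valued.mem_nhds_zero]
  constructor
  · rintro ⟨γ, h⟩
    obtain ⟨a, b, ha, hb, hab⟩ := Valuation.exists_div_eq_of_unit _ γ
    have hne : Valued.v (a / b) ≠ 0 := by
      rw [map_div₀]; exact div_ne_zero ha.ne' hb.ne'
    refine ⟨-WithZero.log (Valued.v (a / b)) + 1, fun x hx => h ?_⟩
    rw [Set.mem_ofPred_eq, ← hab, ← map_div₀, Valuation.restrict_lt_iff]
    refine lt_of_le_of_lt hx ?_
    conv_rhs => rw [← WithZero.exp_log hne]
    rw [WithZero.exp_lt_exp]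
    omega
  · rintro ⟨D, h⟩
    refine ⟨Units.mk0 (Valued.v.restrict (tL ^ D)) ?_, ?_⟩
    · rw [Ne, Valuation.restrict_eq_zero_iff, map_eq_zero]
      exact zpow_ne_zero _ tL_ne
    · intro x hx
      apply h
      rw [Set.mem_ofPred_eq, Units.val_mk0, Valuation.restrict_lt_iff, tL_zpow] at hx
      exact hx.le

lemma ord_closed (D : ℤ) : IsClosed {x | OrdL D x} := by
  have h := Valued.isClosed_closedBall (LaurentSeries ℚ)
    ((Valued.v (R := LaurentSeries ℚ)).restrict (tL ^ D))
  simp only [Valuation.restrict_le_iff, tL_zpow] at h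
  exact h

instance : NonarchimedeanRing (LaurentSeries ℚ) :=
  (Valued.v (R := LaurentSeries ℚ) (Γ₀ := WithZero (Multiplicative ℤ))).subgroups_basis.nonarchimedean

lemma ord_tendsto {ι : Type*} {l : Filter ι} {f : ι → LaurentSeries ℚ} :
    Filter.Tendsto f l (nhds 0) ↔ ∀ D, ∀ᶠ i in l, OrdL D (f i) := by
  constructor
  · intro h D
    exact h (ord_nhds.mpr ⟨D, fun x hx => hx⟩)
  · intro h s hs
    obtain ⟨D, hD⟩ := ord_nhds.mp hs
    rw [Filter.mem_map]
    filter_upwards [h D] with i hi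
    exact hD _ hi

lemma ord_summable {ι : Type*} {f : ι → LaurentSeries ℚ} (E : ι → ℤ) (h : ∀ i, OrdL (E i) (f i))
    (hE : ∀ D, {i | E i < D}.Finite) : Summable f := by
  apply NonarchimedeanAddGroup.summable_of_tendsto_cofinite_zero
  rw [ord_tendsto]
  intro D
  rw [Filter.eventually_cofinite]
  apply (hE D).subset
  intro i hi
  simp only [Set.mem_ofPred_eq] at hi ⊢
  by_contra hc
  exact hi (ord_mono (by omega) (h i))

lemma fin_bdd {ι : Type*} {E : ι → ℤ} (hE : ∀ D, {i | E i < D}.Finite) : ∃ m, ∀ i, m ≤ E i := by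
  obtain ⟨m, hm⟩ := ((hE 0).image E).bddBelow
  refine ⟨min m 0, fun i => ?_⟩
  rcases lt_or_ge (E i) 0 with h | h
  · exact (min_le_left _ _).trans (hm ⟨i, h, rfl⟩)
  · exact (min_le_right _ _).trans h

lemma fin_prod {ι κ : Type*} {E : ι → ℤ} {F : κ → ℤ} (hE : ∀ D, {i | E i < D}.Finite)
    (hF : ∀ D, {i | F i < D}.Finite) (D : ℤ) : {p : ι × κ | E p.1 + F p.2 < D}.Finite := by
  obtain ⟨m, hm⟩ := fin_bdd hE
  obtain ⟨m', hm'⟩ := fin_bdd hF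
  apply ((hE (D - m')).prod (hF (D - m))).subset
  rintro ⟨i, j⟩ h
  have := hm i
  have := hm' j
  simp only [Set.mem_ofPred_eq, Set.mem_prod] at h ⊢
  omega

/-- finite products of factors close to one. -/
lemma ord_prod (N : ℕ) (s : Finset ℕ) (h : ∀ i ∈ s, N ≤ i) :
    OrdL (4 * (N + 1)) ((∏ k ∈ s, (1 - tL ^ (4 * (k + 1)))) - 1) := by
  induction s using Finset.induction_on with
  | empty => simpa using ord_zero _
  | insert a s ha ih =>
    rw [Finset.prod_insert ha]
    have h1 := ih (fun i hi => h i (Finset.mem_insert_of_mem hi))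
    have h2 : OrdL (4 * (N + 1)) (tL ^ (4 * (a + 1))) := by
      have := ord_zpow (4 * (a + 1))
      have e : tL ^ (4 * (a + 1)) = tL ^ (4 * ((a : ℤ) + 1)) := by
        exact_mod_cast (zpow_natCast tL (4 * (a + 1))).symm
      rw [e]
      exact ord_mono (by have := h a (Finset.mem_insert_self _ _); omega) this
    have e : (1 - tL ^ (4 * (a + 1))) * (∏ k ∈ s, (1 - tL ^ (4 * (k + 1)))) - 1
      = ((∏ k ∈ s, (1 - tL ^ (4 * (k + 1)))) - 1)
        - (tL ^ (4 * (a + 1)) * ((∏ k ∈ s, (1 - tL ^ (4 * (k + 1)))) - 1) + tL ^ (4 * (a + 1))) := by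
      ring
    rw [e]
    refine ord_sub h1 (ord_add (ord_mono ?_ (ord_mul h2 h1)) h2)
    omega

lemma v_one_of_sub {x : LaurentSeries ℚ} {D : ℤ} (hD : 1 ≤ D) (h : OrdL D (x - 1)) :
    Valued.v x = 1 := by
  have h2 : Valued.v (x - 1) < Valued.v (1 : LaurentSeries ℚ) := by
    rw [map_one]
    refine lt_of_le_of_lt h ?_
    rw [← WithZero.exp_zero, WithZero.exp_lt_exp]; omega
  have := Valuation.map_add_eq_of_lt_left _ h2
  rw [add_sub_cancel, map_one] at this
  exact this

lemma qp_v (n : ℕ) : Valued.v (qp tL n) = 1 := by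
  unfold qp
  exact v_one_of_sub (D := 4 * ((0 : ℕ) + 1)) (by norm_num)
    (ord_prod 0 _ (fun i _ => Nat.zero_le i))

lemma qp_ne (n : ℕ) : qp tL n ≠ 0 := by
  intro h
  have := qp_v n
  rw [h, map_zero] at this
  exact zero_ne_one this

lemma ord_unit_mul {x y : LaurentSeries ℚ} (hx : Valued.v x = 1) {D : ℤ} :
    OrdL D (x * y) ↔ OrdL D y := by
  unfold OrdL; rw [map_mul, hx, one_mul]

lemma qp_sub (N M : ℕ) : OrdL (4 * (N + 1)) (qp tL (N + M) - qp tL N) := by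
  have : qp tL (N + M) - qp tL N
    = qp tL N * ((∏ k ∈ Finset.Ico N (N + M), (1 - tL ^ (4 * (k + 1)))) - 1) := by
    unfold qp
    rw [mul_sub, mul_one, Finset.prod_range_mul_prod_Ico _ (Nat.le_add_right _ _)]
  rw [this, ord_unit_mul (qp_v N)]
  exact ord_prod N _ (fun i hi => (Finset.mem_Ico.mp hi).1)

lemma qp_lim : ∃ P, Filter.Tendsto (fun n => qp tL n) Filter.atTop (nhds P) := by
  have hs : Summable (fun n => qp tL (n + 1) - qp tL n) := by
    refine ord_summable (fun n => 4 * ((n : ℤ) + 1)) (fun n => qp_sub n 1) ?_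
    intro D
    apply (Set.finite_Iio D.toNat).subset
    intro i hi
    simp only [Set.mem_ofPred_eq, Set.mem_Iio] at hi ⊢
    omega
  have h := hs.hasSum.tendsto_sum_nat
  simp only [Finset.sum_range_sub] at h
  refine ⟨_, (h.add_const (qp tL 0)).congr (fun n => ?_)⟩
  ring

lemma lim_sub {P : LaurentSeries ℚ} (hP : Filter.Tendsto (fun n => qp tL n) Filter.atTop (nhds P))
    (N : ℕ) : OrdL (4 * (N + 1)) (P - qp tL N) := by
  refine (ord_closed (4 * (N + 1))).mem_of_tendsto (hP.sub_const (qp tL N)) ?_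
  filter_upwards [Filter.eventually_ge_atTop N] with n hn
  obtain ⟨m, rfl⟩ := Nat.exists_eq_add_of_le hn
  exact qp_sub N m

lemma euler_hasProd {P : LaurentSeries ℚ}
    (hP : Filter.Tendsto (fun n => qp tL n) Filter.atTop (nhds P)) :
    HasProd (fun k : ℕ => 1 - tL ^ (4 * (k + 1))) P := by
  unfold HasProd
  rw [← tendsto_sub_nhds_zero_iff, SummationFilter.unconditional_filter, ord_tendsto]
  intro D
  filter_upwards [Filter.eventually_ge_atTop (Finset.range D.toNat)] with s hs
  have h1 := lim_sub hP D.toNat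
  have h2 : OrdL (4 * (D.toNat + 1)) ((∏ k ∈ s, (1 - tL ^ (4 * (k + 1)))) - qp tL D.toNat) := by
    have : (∏ k ∈ s, (1 - tL ^ (4 * (k + 1)))) - qp tL D.toNat = qp tL D.toNat *
        ((∏ k ∈ s \ Finset.range D.toNat, (1 - tL ^ (4 * (k + 1)))) - 1) := by
      unfold qp
      rw [mul_sub, mul_one, mul_comm, Finset.prod_sdiff hs]
    rw [this, ord_unit_mul (qp_v _)]
    apply ord_prod
    intro i hi
    simp only [Finset.mem_sdiff, Finset.mem_range] at hi
    omega
  have h3 := ord_sub h2 h1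
  rw [sub_sub_sub_cancel_right] at h3
  exact ord_mono (by omega) h3

lemma euler_tendsto : Filter.Tendsto (fun n => qp tL n) Filter.atTop (nhds eulerInf) := by
  obtain ⟨P, hP⟩ := qp_lim
  have : eulerInf = P := (euler_hasProd hP).tprod_eq
  rw [this]; exact hP

lemma euler_v : Valued.v eulerInf = 1 := by
  have h := lim_sub euler_tendsto 0
  exact v_one_of_sub (D := 4 * ((0 : ℕ) + 1)) (by norm_num) (by simpa [qp] using h)

lemma euler_ne : eulerInf ≠ 0 := by
  intro h
  have := euler_v
  rw [h, map_zero] at this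
  exact zero_ne_one this

lemma rq_ord (n : ℤ) : OrdL 0 (rq tL n) := by
  unfold rq
  split_ifs
  · unfold OrdL; rw [map_inv₀, qp_v]; simp
  · exact ord_zero _

lemma rq_sub (n : ℕ) : OrdL (4 * (n + 1)) (rq tL n - eulerInf⁻¹) := by
  rw [rq_nat]
  have : (qp tL n)⁻¹ - eulerInf⁻¹ = (qp tL n)⁻¹ * (eulerInf⁻¹ * (eulerInf - qp tL n)) := by
    have := qp_ne n
    have := euler_ne
    field_simp
  rw [this, ord_unit_mul (by rw [map_inv₀, qp_v, inv_one]),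
    ord_unit_mul (by rw [map_inv₀, euler_v, inv_one])]
  exact lim_sub euler_tendsto n

lemma rq_tendsto : Filter.Tendsto (fun n : ℤ => rq tL n) Filter.atTop (nhds eulerInf⁻¹) := by
  rw [← tendsto_sub_nhds_zero_iff, ord_tendsto]
  intro D
  filter_upwards [Filter.eventually_ge_atTop (max D 0)] with n hn
  obtain ⟨m, rfl⟩ := Int.eq_ofNat_of_zero_le ((le_max_right _ _).trans hn)
  exact ord_mono (by have := (le_max_left _ _).trans hn; omega) (rq_sub m)


/-- the Bailey summand. -/
def fJ (J : ℤ) (n : ℕ) : LaurentSeries ℚ :=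
  tL ^ (4 * ((n : ℤ) ^ 2 + n)) * (rq tL (n - J) * rq tL (n + J + 1))

lemma fJ_ord (J : ℤ) (n : ℕ) : OrdL (4 * ((n : ℤ) ^ 2 + n)) (fJ J n) := by
  have := ord_mul (ord_zpow (4 * ((n : ℤ) ^ 2 + n))) (ord_mul (rq_ord (n - J)) (rq_ord (n + J + 1)))
  unfold fJ
  simpa using this

lemma fJ_summable (J : ℤ) : Summable (fJ J) := by
  refine ord_summable _ (fJ_ord J) ?_
  intro D
  apply (Set.finite_Iio D.toNat).subset
  intro i hi
  simp only [Set.mem_ofPred_eq, Set.mem_Iio] at hi ⊢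
  have : (0 : ℤ) ≤ (i : ℤ) ^ 2 := by positivity
  omega

lemma shift_atTop (c : ℤ) : Filter.Tendsto (fun M : ℕ => (M : ℤ) + c) Filter.atTop Filter.atTop :=
  Filter.tendsto_atTop_add_const_right _ c tendsto_natCast_atTop_atTop

lemma euler_sum (J : ℤ) : ∑' n, fJ J n = tL ^ (4 * (J ^ 2 + J)) * eulerInf⁻¹ := by
  have h1 : Filter.Tendsto (fun M : ℕ => ∑ n ∈ Finset.range (M + 1), fJ J n) Filter.atTop
      (nhds (∑' n, fJ J n)) :=
    (fJ_summable J).hasSum.tendsto_sum_nat.comp (Filter.tendsto_add_atTop_nat 1)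
  have h2 : Filter.Tendsto (fun M : ℕ => tL ^ (4 * (J ^ 2 + J))
      * (rq tL ((M : ℤ) - J) * rq tL (M + J + 1))) Filter.atTop
      (nhds (tL ^ (4 * (J ^ 2 + J)) * (eulerInf⁻¹ * eulerInf⁻¹))) := by
    refine Filter.Tendsto.const_mul _ (Filter.Tendsto.mul ?_ ?_)
    · exact rq_tendsto.comp (shift_atTop (-J))
    · have := rq_tendsto.comp (shift_atTop (J + 1))
      simpa only [Function.comp_def, ← add_assoc] using this
  have h3 : Filter.Tendsto (fun M : ℕ => (tL ^ (4 * (J ^ 2 + J))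
      * (rq tL ((M : ℤ) - J) * rq tL (M + J + 1)))
      - eulerInf⁻¹ * ∑ n ∈ Finset.range (M + 1), fJ J n) Filter.atTop (nhds 0) := by
    rw [ord_tendsto]
    intro D
    filter_upwards [Filter.eventually_ge_atTop D.toNat] with M hM
    rw [← bailey_step tL_ne qp_ne, Finset.mul_sum, ← Finset.sum_sub_distrib]
    apply ord_sum
    intro n hn
    rw [Finset.mem_range] at hn
    obtain ⟨m, rfl⟩ := Nat.exists_eq_add_of_le (Nat.lt_succ_iff.mp hn)
    have e : tL ^ (4 * ((n : ℤ) ^ 2 + n)) * rq tL (((n + m : ℕ) : ℤ) - n)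
        * (rq tL (n - J) * rq tL (n + J + 1)) - eulerInf⁻¹ * fJ J n
        = (rq tL (m : ℤ) - eulerInf⁻¹) * fJ J n := by
      unfold fJ
      rw [show ((n + m : ℕ) : ℤ) - n = m by push_cast; ring]
      ring
    rw [e]
    refine ord_mono ?_ (ord_mul (rq_sub m) (fJ_ord J n))
    have : (0 : ℤ) ≤ (n : ℤ) ^ 2 := by positivity
    omega
  have h4 := h2.sub h3
  simp only [sub_sub_cancel, sub_zero] at h4
  have h5 := tendsto_nhds_unique (h1.const_mul eulerInf⁻¹) h4
  apply mul_left_cancel₀ (inv_ne_zero euler_ne)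
  rw [h5]; ring

/-- the Bailey chain weights. -/
def aN (k : ℕ) (n : Fin k → ℕ) : LaurentSeries ℚ := tL ^ (4 * tadE k n) * (denP tL k n)⁻¹

/-- the last component. -/
def lN (k : ℕ) (n : Fin k → ℕ) : ℤ := mAtN k n k

lemma denP_v (k : ℕ) (n : Fin k → ℕ) : Valued.v (denP tL k n) = 1 := by
  unfold denP
  rw [map_prod]
  apply Finset.prod_eq_one
  intro i _
  split_ifs
  · exact qp_v _
  · exact map_one _

lemma tadB_nonneg (k : ℕ) {v w : Fin k → ℤ} (hv : ∀ i, 0 ≤ v i) (hw : ∀ i, 0 ≤ w i) :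
    0 ≤ tadB k v w := by
  unfold tadB
  refine Finset.sum_nonneg fun i _ => Finset.sum_nonneg fun l _ => ?_
  refine mul_nonneg (mul_nonneg (hv i) ?_) (hw l)
  positivity

lemma tadE_ge (k : ℕ) (n : Fin (k + 1) → ℕ) : ((∑ i, n i : ℕ) : ℤ) ≤ tadE (k + 1) n := by
  unfold tadE
  rw [tadB_cons]
  have h1 : 0 ≤ tadB k (fun i : Fin k => (n i.succ : ℤ))
      (fun i : Fin k => (n i.succ : ℤ) + (if ((i.succ : Fin (k + 1)) : ℕ) + 1 = k + 1 then 1 else 0)) := by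
    apply tadB_nonneg
    · intro i; positivity
    · intro i; split_ifs <;> positivity
  have h2 : ((∑ i, n i : ℕ) : ℤ) ≤ ∑ i : Fin (k + 1), ((n i : ℤ)
      + (if (i : ℕ) + 1 = k + 1 then 1 else 0)) := by
    push_cast
    apply Finset.sum_le_sum
    intro i _
    split_ifs <;> omega
  have h3 : ∑ i, (n i : ℤ) = ((∑ i, n i : ℕ) : ℤ) := by push_cast; rfl
  rw [h3]
  set S := ∑ i, n i
  have h4 : (S : ℤ) ≤ (S : ℤ) * S := by exact_mod_cast Nat.le_mul_self S
  have h5 := mul_le_mul_of_nonneg_left h2 (Int.natCast_nonneg S)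
  linarith

lemma sum_fin (k : ℕ) (D : ℤ) : {n : Fin k → ℕ | 4 * ((∑ i, n i : ℕ) : ℤ) < D}.Finite := by
  refine Set.Finite.subset (Set.Finite.pi' (fun _ : Fin k => Set.finite_Iic D.toNat)) ?_
  intro n hn i
  simp only [Set.mem_ofPred_eq, Set.mem_Iic] at hn ⊢
  have := Finset.single_le_sum (f := n) (fun i _ => Nat.zero_le _) (Finset.mem_univ i)
  omega

lemma aN_ord (k : ℕ) (n : Fin (k + 1) → ℕ) : OrdL (4 * ((∑ i, n i : ℕ) : ℤ)) (aN (k + 1) n) := by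
  unfold aN
  have hv : Valued.v (denP tL (k + 1) n)⁻¹ = 1 := by rw [map_inv₀, denP_v, inv_one]
  rw [mul_comm (tL ^ _) _, ord_unit_mul hv]
  have h := tadE_ge k n
  have h2 : 4 * ((∑ i, n i : ℕ) : ℤ) ≤ 4 * tadE (k + 1) n := by linarith
  exact ord_mono h2 (ord_zpow _)

lemma bailey_J (k : ℕ) (J : ℤ) :
    ∑' n : Fin (k + 1) → ℕ, aN (k + 1) n * (rq tL (lN (k + 1) n - J) * rq tL (lN (k + 1) n + J + 1))
      = tL ^ (4 * ((k + 1 : ℕ) * (J ^ 2 + J))) * eulerInf⁻¹ := by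
  set F : (Fin (k + 1) → ℕ) → LaurentSeries ℚ := fun n =>
    aN (k + 1) n * (rq tL (lN (k + 1) n - J) * rq tL (lN (k + 1) n + J + 1)) with hF
  have hs : Summable F := by
    refine ord_summable (fun n => 4 * ((∑ i, n i : ℕ) : ℤ)) (fun n => ?_) (sum_fin _)
    have := ord_mul (aN_ord k n) (ord_mul (rq_ord (lN (k + 1) n - J)) (rq_ord (lN (k + 1) n + J + 1)))
    simpa using this
  have hs' : Summable fun p => F (Finset.Nat.sigmaAntidiagonalTupleEquivTuple (k + 1) p) :=
    (Finset.Nat.sigmaAntidiagonalTupleEquivTuple (k + 1)).summable_iff.mpr hs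
  rw [← (Finset.Nat.sigmaAntidiagonalTupleEquivTuple (k + 1)).tsum_eq F]
  rw [Summable.tsum_sigma' (fun c => (hasSum_fintype _).summable) hs']
  have h1 : ∀ M : ℕ, ∑' c : (Finset.Nat.antidiagonalTuple (k + 1) M : Finset _),
      F ((Finset.Nat.sigmaAntidiagonalTupleEquivTuple (k + 1)) ⟨M, c⟩)
      = tL ^ (4 * (k * (J ^ 2 + J))) * fJ J M := by
    intro M
    have h2 := Finset.tsum_subtype (Finset.Nat.antidiagonalTuple (k + 1) M) F
    have h3 := bailey_fin tL_ne qp_ne J k M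
    refine (h2.trans h3).trans ?_
    unfold fJ
    ring
  rw [tsum_congr h1, tsum_mul_left, euler_sum, ← mul_assoc, ← zpow_add₀ tL_ne]
  congr 2
  push_cast
  ring

theorem bailey_inf (k : ℕ) (J c : ℤ → ℤ) (hc : ∀ D, {j | c j < D}.Finite) :
    HasSum (fun n : Fin (k + 1) → ℕ => ∑' j : ℤ, aN (k + 1) n
        * (tL ^ c j * (rq tL (lN (k + 1) n - J j) * rq tL (lN (k + 1) n + J j + 1))))
      (eulerInf⁻¹ * ∑' j : ℤ, tL ^ (c j + 4 * ((k + 1 : ℕ) * (J j ^ 2 + J j)))) := by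
  set g : (Fin (k + 1) → ℕ) × ℤ → LaurentSeries ℚ := fun p => aN (k + 1) p.1
        * (tL ^ c p.2 * (rq tL (lN (k + 1) p.1 - J p.2) * rq tL (lN (k + 1) p.1 + J p.2 + 1))) with hg
  have hs : Summable g := by
    refine ord_summable _ (fun p => ?_) (fin_prod (sum_fin (k + 1)) hc)
    have := ord_mul (aN_ord k p.1) (ord_mul (ord_zpow (c p.2))
      (ord_mul (rq_ord (lN (k + 1) p.1 - J p.2)) (rq_ord (lN (k + 1) p.1 + J p.2 + 1))))
    simpa using this
  have h1 : ∀ n, Summable fun j => g (n, j) := fun n => hs.prod_factor n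
  have h2 := hs.hasSum.prod_fiberwise (fun n => (h1 n).hasSum)
  have h3 : ∑' p, g p = eulerInf⁻¹ * ∑' j : ℤ, tL ^ (c j + 4 * ((k + 1 : ℕ) * (J j ^ 2 + J j))) := by
    have hs2 : Summable (Function.uncurry fun n j => g (n, j)) := hs
    rw [hs.tsum_prod, ← hs2.tsum_comm, ← tsum_mul_left]
    apply tsum_congr
    intro j
    have h4 : ∀ n, g (n, j) = tL ^ c j * (aN (k + 1) n
        * (rq tL (lN (k + 1) n - J j) * rq tL (lN (k + 1) n + J j + 1))) := by
      intro n; simp only [hg]; ring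
    rw [tsum_congr h4, tsum_mul_left, bailey_J, zpow_add₀ tL_ne]
    ring
  rw [h3] at h2
  exact h2

lemma pow_summable {c : ℤ → ℤ} (hc : ∀ D, {j | c j < D}.Finite) :
    Summable fun j => tL ^ c j := ord_summable c (fun _ => ord_zpow _) hc


lemma ferm_sum (r a b : ℕ) (hr : 3 ≤ r) (ha : 1 ≤ a) (ha' : a ≤ r - 1) (hb : 1 ≤ b)
    (hb' : b ≤ r - 2) (N : ℤ) (X Y : LaurentSeries ℚ) :
    ∑' m : Fin (r - 3) → ℕ, (if parity r a b m then
        X * Y * tL ^ (quadC (r - 3) m - 2 * mAt (r - 3) m ((r : ℤ) - a - 1))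
          * ∏ i : Fin (r - 3), gaussHalf tL (topC r a b N m i) (m i)
        else 0)
      = X * Y * Fc (r - 3) ((r : ℤ) - a - 1) tL ((r : ℤ) - b - 1) N := by
  unfold Fc FS
  rw [← tsum_eq_finsum (L := SummationFilter.unconditional _) (fT_support _ _ _ _ _), ← tsum_mul_left]
  apply tsum_congr
  intro m
  unfold fT
  have hpar : parity r a b m ↔ ∀ i : Fin (r - 3),
      ((m i : ℤ) - Pc ((r : ℤ) - a - 1) ((r : ℤ) - b - 1) ((i : ℕ) + 1)) % 2 = 0 := by
    unfold parity
    apply forall_congr'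
    intro i
    have := i.2
    unfold Qab Pc
    omega
  by_cases h : parity r a b m
  · rw [if_pos h, if_pos (hpar.mp h), mul_assoc]
    congr 2
    apply Finset.prod_congr rfl
    intro i _
    congr 1
    unfold topC uv eZ
    ring
  · rw [if_neg h, if_neg (fun hc => h (hpar.mpr hc)), mul_zero]

/-- the bosonic exponents -/
def xA (r a b j : ℤ) : ℤ := a + 2 * r * j - b

/-- the reflected bosonic exponents -/
def xB (r a b j : ℤ) : ℤ := -a - 2 * r * j - b

/-- exponents of the first family -/
def cA1 (r a b j : ℤ) : ℤ := cB r a j + xA r a b j * (xA r a b j - 1)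

/-- exponents of the second family -/
def cA2 (r a b j : ℤ) : ℤ := cB r a j - 2 * a - 4 * r * j + xB r a b j * (xB r a b j - 1)

lemma wB_half (N : ℕ) (x J : ℤ) (h : x = 2 * J + 1) :
    (qp tL (2 * N + 1))⁻¹ * wB tL ((2 * N + 1 : ℕ) : ℤ) x
      = tL ^ (x * (x - 1)) * (rq tL (N - J) * rq tL (N + J + 1)) := by
  unfold wB
  rw [gauss_rq _ (Int.natCast_nonneg _), Int.toNat_natCast,
    show (((2 * N + 1 : ℕ) : ℤ) + x) / 2 = N + J + 1 by omega,
    show ((2 * N + 1 : ℕ) : ℤ) - (N + J + 1) = N - J by push_cast; ring]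
  have := qp_ne (2 * N + 1)
  field_simp

lemma BB_half (r a b : ℤ) (hr : 1 ≤ r) (hab : (a - b) % 2 = 1) (N : ℕ) :
    (qp tL (2 * N + 1))⁻¹ * BB tL r a b ((2 * N + 1 : ℕ) : ℤ)
      = (∑' j : ℤ, tL ^ cA1 r a b j * (rq tL (N - (xA r a b j - 1) / 2)
          * rq tL (N + (xA r a b j - 1) / 2 + 1)))
        - ∑' j : ℤ, tL ^ cA2 r a b j * (rq tL (N - (xB r a b j - 1) / 2)
          * rq tL (N + (xB r a b j - 1) / 2 + 1)) := by
  unfold BB tB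
  have s1 : Function.HasFiniteSupport fun j : ℤ => tL ^ cB r a j
      * wB tL ((2 * N + 1 : ℕ) : ℤ) (a + 2 * r * j - b) := supp1 hr _
  have s2 : Function.HasFiniteSupport fun j : ℤ => tL ^ (cB r a j - 2 * a - 4 * r * j)
      * wB tL ((2 * N + 1 : ℕ) : ℤ) (-a - 2 * r * j - b) := supp2 hr _
  rw [finsum_sub_distrib s1 s2, ← tsum_eq_finsum (L := SummationFilter.unconditional _) s1,
    ← tsum_eq_finsum (L := SummationFilter.unconditional _) s2, mul_sub, ← tsum_mul_left, ← tsum_mul_left]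
  congr 1
  · apply tsum_congr
    intro j
    have e : 2 * r * j = 2 * (r * j) := by ring
    rw [mul_left_comm, wB_half N _ ((xA r a b j - 1) / 2) (by unfold xA; omega), ← mul_assoc,
      ← zpow_add₀ tL_ne]
    rfl
  · apply tsum_congr
    intro j
    have e : 2 * r * j = 2 * (r * j) := by ring
    rw [mul_left_comm, wB_half N _ ((xB r a b j - 1) / 2) (by unfold xB; omega), ← mul_assoc,
      ← zpow_add₀ tL_ne]
    rfl

lemma quad_fin {A B C : ℤ} (hA : 1 ≤ A) (D : ℤ) : {j : ℤ | A * j ^ 2 + B * j + C < D}.Finite := by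
  apply (Set.finite_Icc (-(|B| + |D - C|)) (|B| + |D - C|)).subset
  intro j hj
  simp only [Set.mem_ofPred_eq, Set.mem_Icc] at hj ⊢
  rw [← abs_le]
  by_contra hc
  push Not at hc
  have h1 : A * j ^ 2 ≥ |j| * |j| := by
    rw [abs_mul_abs_self]; nlinarith [sq_nonneg j]
  have h2 : B * j ≥ -(|B| * |j|) := by rw [← abs_mul]; exact neg_abs_le _
  have h3 := le_abs_self (D - C)
  have h4 := abs_nonneg B
  have h5 := abs_nonneg (D - C)
  nlinarith

lemma cA1_fin (r a b : ℤ) (hr : 2 ≤ r) (D : ℤ) : {j | cA1 r a b j < D}.Finite := by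
  have h : ∀ j, cA1 r a b j = (4 * r * (r - 1)) * j ^ 2
      + (-4 * a + 2 * r + 4 * r * (a - b) - 2 * r) * j + (a - b) * (a - b - 1) := by
    intro j; unfold cA1 cB xA; ring
  simp only [h]
  exact quad_fin (by nlinarith) D

lemma cA2_fin (r a b : ℤ) (hr : 2 ≤ r) (D : ℤ) : {j | cA2 r a b j < D}.Finite := by
  have h : ∀ j, cA2 r a b j = (4 * r * (r - 1)) * j ^ 2
      + (-4 * a + 2 * r - 4 * r + 4 * r * (a + b) + 2 * r) * j + ((a + b) * (a + b + 1) - 2 * a) := by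
    intro j; unfold cA2 cB xB; ring
  simp only [h]
  exact quad_fin (by nlinarith) D

lemma add_fin {c : ℤ → ℤ} (hc : ∀ D, {j | c j < D}.Finite) (k : ℕ) (J : ℤ → ℤ) (D : ℤ) :
    {j | c j + 4 * ((k : ℤ) * (J j ^ 2 + J j)) < D}.Finite := by
  apply (hc D).subset
  intro j hj
  simp only [Set.mem_ofPred_eq] at hj ⊢
  have h : 0 ≤ J j ^ 2 + J j := by
    rcases le_or_gt 0 (J j) with h | h <;> nlinarith
  have := mul_nonneg (Int.natCast_nonneg k) h
  omega

/-- **Rogers–Ramanujan identity for `χ^{(r,(k+1)r-1)}_{a,(k+1)b}(q)`, case `a ≢ b (mod 2)`**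
(Bailey chain of length `k` applied to Melzer's identities), stated in the variable
`t = q^{1/4}` (all exponents multiplied by `4`). -/
theorem bailey_chain_odd (k r a b : ℕ) (hk : 1 ≤ k) (hr : 3 ≤ r) (ha : 1 ≤ a)
    (ha' : a ≤ r - 1) (hb : 1 ≤ b) (hb' : b ≤ r - 2) (hab : a % 2 ≠ b % 2) :
    virChar r ((k + 1) * r - 1) a ((k + 1) * b)
      = tL ^ (-(((a : ℤ) - b) * ((a : ℤ) - b - 1)) - (k : ℤ) * (((a : ℤ) - b) ^ 2 - 1))
          * ∑' n : Fin k → ℕ, ∑' m : Fin (r - 3) → ℕ,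
            (if parity r a b m then
              tL ^ (4 * tadB k (fun i => (n i : ℤ))
                  (fun i => (n i : ℤ) + (if (i : ℕ) + 1 = k then 1 else 0)))
                * ((∏ i : Fin k, if (i : ℕ) + 1 < k then qp tL (n i) else 1)
                    * qp tL (2 * mAtN k n k + 1))⁻¹
                * tL ^ (quadC (r - 3) m - 2 * mAt (r - 3) m ((r : ℤ) - a - 1))
                * ∏ i : Fin (r - 3),
                    gaussHalf tL (topC r a b (2 * (mAtN k n k : ℤ) + 1) m i) (m i)
            else 0) := by
  obtain ⟨k, rfl⟩ : ∃ k', k = k' + 1 := ⟨k - 1, by omega⟩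
  have hsum : ∀ n : Fin (k + 1) → ℕ, ∑' m : Fin (r - 3) → ℕ,
            (if parity r a b m then
              tL ^ (4 * tadB (k + 1) (fun i => (n i : ℤ))
                  (fun i => (n i : ℤ) + (if (i : ℕ) + 1 = k + 1 then 1 else 0)))
                * ((∏ i : Fin (k + 1), if (i : ℕ) + 1 < k + 1 then qp tL (n i) else 1)
                    * qp tL (2 * mAtN (k + 1) n (k + 1) + 1))⁻¹
                * tL ^ (quadC (r - 3) m - 2 * mAt (r - 3) m ((r : ℤ) - a - 1))
                * ∏ i : Fin (r - 3),
                    gaussHalf tL (topC r a b (2 * (mAtN (k + 1) n (k + 1) : ℤ) + 1) m i) (m i)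
            else 0)
      = (∑' j : ℤ, aN (k + 1) n * (tL ^ cA1 r a b j * (rq tL (lN (k + 1) n - (xA r a b j - 1) / 2)
          * rq tL (lN (k + 1) n + (xA r a b j - 1) / 2 + 1))))
        - ∑' j : ℤ, aN (k + 1) n * (tL ^ cA2 r a b j * (rq tL (lN (k + 1) n - (xB r a b j - 1) / 2)
          * rq tL (lN (k + 1) n + (xB r a b j - 1) / 2 + 1))) := by
    intro n
    rw [ferm_sum r a b hr ha ha' hb hb']
    set N := mAtN (k + 1) n (k + 1) with hN
    have h1 := Fc_eq (d := r - 3) (s := (r : ℤ) - a - 1) tL_ne qp_ne (by omega) (by omega)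
      (2 * N + 1) ((r : ℤ) - b - 1) (by omega) (by omega) (by omega)
    rw [show (((r - 3 : ℕ) : ℤ) + 3) = r by omega,
      show (((r - 3 : ℕ) : ℤ) + 2 - ((r : ℤ) - a - 1)) = a by omega,
      show (((r - 3 : ℕ) : ℤ) + 2 - ((r : ℤ) - b - 1)) = b by omega] at h1
    have h2 : ((2 * N + 1 : ℕ) : ℤ) = 2 * (N : ℤ) + 1 := by push_cast; rfl
    have h3 := BB_half r a b (by omega) (by omega) N
    rw [← h1, h2] at h3
    rw [mul_inv, ← mul_assoc (tL ^ _), mul_assoc _ (qp tL (2 * N + 1))⁻¹, h3, tsum_mul_left,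
      tsum_mul_left, ← mul_sub]
    rfl
  rw [tsum_congr hsum]
  have hc1 := cA1_fin (r : ℤ) a b (by omega)
  have hc2 := cA2_fin (r : ℤ) a b (by omega)
  have g1 := bailey_inf k (fun j => (xA r a b j - 1) / 2) (cA1 r a b) hc1
  have g2 := bailey_inf k (fun j => (xB r a b j - 1) / 2) (cA2 r a b) hc2
  rw [(g1.sub g2).tsum_eq, ← mul_sub, ← Summable.tsum_sub (pow_summable (add_fin hc1 _ _))
    (pow_summable (add_fin hc2 _ _)), mul_left_comm, ← tsum_mul_left]
  unfold virChar
  congr 1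
  apply tsum_congr
  intro j
  have e : 2 * (r : ℤ) * j = 2 * (r * j) := by ring
  have hp : (((k + 1 + 1) * r - 1 : ℕ) : ℤ) = ((k : ℤ) + 1 + 1) * r - 1 := by
    have : 1 ≤ (k + 1 + 1) * r := Nat.mul_pos (by omega) (by omega)
    push_cast [Nat.cast_sub this]
    ring
  have hJ : ∀ x : ℤ, x % 2 = 1 → 4 * (((x - 1) / 2) ^ 2 + (x - 1) / 2) = x ^ 2 - 1 := by
    intro x hx
    obtain ⟨J, hx⟩ : ∃ J, x = 2 * J + 1 := ⟨x / 2, by omega⟩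
    subst hx
    rw [show (2 * J + 1 - 1) / 2 = J by omega]
    ring
  have j1 := hJ (xA r a b j) (by unfold xA; omega)
  have j2 := hJ (xB r a b j) (by unfold xB; omega)
  rw [mul_sub (tL ^ _), ← zpow_add₀ tL_ne, ← zpow_add₀ tL_ne, hp]
  push_cast
  have k1 : ∀ y : ℤ, 4 * (((k : ℤ) + 1) * y) = ((k : ℤ) + 1) * (4 * y) := fun y => by ring
  rw [k1, k1, j1, j2]
  unfold cA1 cA2 cB xA xB
  congr 2 <;> ring
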